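/- The functor sending an NC-smooth algebra R to the functor h̄_R on aN (where h̄_R(B) is the set of conjugacy classes of algebra homomorphisms R → B) is fully faithful from the opposite of the category of NC-smooth algebras with isomorphisms-up-to-conjugation as morphisms, to the category of functors aN → Set with natural isomorphisms as morphisms. Equivalently, for NC-smooth algebras R, R' the natural map from the set of conjugacy classes of algebra isomorphisms R → R' to the inverse limit over d of the sets of conjugacy classes of isomorphisms R/I_{d+2}R → R'/I_{d+2}R' is a bijection. -/

import Mathlib

noncomputable section

open scoped BigOperators

namespace NCGeom

variable (R : Type) [Ring R] [Algebra ℂ R]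

/-- `lieLCS R n` is the `(n+1)`-st term `R_{n+1}^{Lie}` of the lower central series of `R`
viewed as a Lie algebra under `[a,b] = a*b - b*a`; so `lieLCS R 0 = R` and
`lieLCS R n = [R, lieLCS R (n-1)]`. -/
def lieLCS : ℕ → Submodule ℂ R
  | 0 => ⊤
  | n + 1 => Submodule.span ℂ {x : R | ∃ a ∈ lieLCS n, ∃ b : R, x = a * b - b * a}

/-- The set of products `r₀ · a₁ · r₁ · … · aₘ · rₘ` where `aₖ ∈ R_{iₖ}^{Lie}`, `iₖ ≥ 2` and
`i₁ + … + iₘ ≥ n`. -/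
def commSet (n : ℕ) : Set R :=
  {x : R | ∃ (m : ℕ) (i : Fin m → ℕ) (r : Fin (m + 1) → R) (a : Fin m → R),
    (∀ k, 2 ≤ i k) ∧ (n ≤ ∑ k, i k) ∧ (∀ k, a k ∈ lieLCS R (i k - 1)) ∧
    x = r 0 * (List.ofFn fun k : Fin m => a k * r k.succ).prod}

/-- The commutator filtration
`I_n R = Σ_{i₁,…,iₘ ≥ 2, i₁+…+iₘ ≥ n} R·R_{i₁}^{Lie}·R·…·R·R_{iₘ}^{Lie}·R`
(the two-sided ideal spanned by the corresponding products). -/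
def commFiltration (n : ℕ) : TwoSidedIdeal R := TwoSidedIdeal.span (commSet R n)

/-- `R` is NC-nilpotent of degree `d` if `I_{d+2} R = 0`. -/
def IsNCNilpotentOfDegree (d : ℕ) : Prop := ∀ x ∈ commFiltration R (d + 2), x = 0

/-- `R` is NC-nilpotent if it is NC-nilpotent of some degree, i.e. belongs to `𝒩`. -/
def IsNCNilpotent : Prop := ∃ d, IsNCNilpotentOfDegree R d

variable {R}

/-- A surjection `π : R → S` onto a commutative algebra exhibits `S` as the abelianization
`R^{ab} = R/I₂R` of `R` if its kernel is exactly `I₂R`. -/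
def IsAbelianization {S : Type} [CommRing S] [Algebra ℂ S] (π : R →ₐ[ℂ] S) : Prop :=
  Function.Surjective π ∧ ∀ x : R, π x = 0 ↔ x ∈ commFiltration R 2

/-- A central extension `0 → I → Λ' → Λ → 0` in `𝒩`: a surjection whose kernel `I` is a
central ideal with `I² = 0`. -/
structure IsCentralExtension {Λ' Λ : Type} [Ring Λ'] [Algebra ℂ Λ'] [Ring Λ] [Algebra ℂ Λ]
    (p : Λ' →ₐ[ℂ] Λ) : Prop where
  surjective : Function.Surjective p
  central : ∀ x : Λ', p x = 0 → ∀ y : Λ', x * y = y * x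
  sq_zero : ∀ x y : Λ', p x = 0 → p y = 0 → x * y = 0

variable (R) in
/-- An NC-nilpotent algebra `A` of degree `d` is `d`-smooth if for every central extension
`B' → B` in `𝒩_d`, every homomorphism `A → B` lifts to `A → B'`. -/
def IsdSmooth (d : ℕ) : Prop :=
  IsNCNilpotentOfDegree R d ∧
  ∀ (Λ' Λ : Type) (_ : Ring Λ') (_ : Algebra ℂ Λ') (_ : Ring Λ) (_ : Algebra ℂ Λ),
    IsNCNilpotentOfDegree Λ' d → IsNCNilpotentOfDegree Λ d →
    ∀ p : Λ' →ₐ[ℂ] Λ, IsCentralExtension p →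
      ∀ f : R →ₐ[ℂ] Λ, ∃ g : R →ₐ[ℂ] Λ', p.comp g = f

variable (R) in
/-- `R` is NC-complete: complete and separated with respect to the commutator filtration. -/
def IsNCComplete : Prop :=
  (∀ x : R, (∀ n, x ∈ commFiltration R n) → x = 0) ∧
  (∀ x : ℕ → R, (∀ n, x (n + 1) - x n ∈ commFiltration R n) →
    ∃ y : R, ∀ n, y - x n ∈ commFiltration R n)

variable (R) in
/-- `R` is NC-smooth: NC-complete, and homomorphisms from `R` to NC-nilpotent algebras lift
along all central extensions in `𝒩`. -/
def IsNCSmooth : Prop :=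
  IsNCComplete R ∧
  ∀ (Λ' Λ : Type) (_ : Ring Λ') (_ : Algebra ℂ Λ') (_ : Ring Λ) (_ : Algebra ℂ Λ),
    IsNCNilpotent Λ' → IsNCNilpotent Λ →
    ∀ p : Λ' →ₐ[ℂ] Λ, IsCentralExtension p →
      ∀ f : R →ₐ[ℂ] Λ, ∃ g : R →ₐ[ℂ] Λ', p.comp g = f

/-- Two algebra homomorphisms `f, g : A → B` are conjugate (equal in the category `a𝒩`)
if `g = u f u⁻¹` for a unit `u ∈ B`. -/
def Conjugate {A B : Type} [Ring A] [Algebra ℂ A] [Ring B] [Algebra ℂ B]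
    (f g : A →ₐ[ℂ] B) : Prop :=
  ∃ u : Bˣ, ∀ a : A, g a = ↑u * f a * ↑u⁻¹

end NCGeom

namespace NCGeom

section Filtration

variable {R : Type} [Ring R] [Algebra ℂ R]

/-- Products `r₀ · a₁ · r₁ · … · aₘ · rₘ` of lower central series elements, of total weight `n`. -/
inductive CommProd : ℕ → R → Prop
  | base (r : R) : CommProd 0 r
  | cons {n : ℕ} {x : R} (r : R) {a : R} {k : ℕ} (ha : a ∈ lieLCS R (k + 1))
      (hx : CommProd n x) : CommProd (k + 2 + n) (r * a * x)

lemma CommProd.mul_left {n : ℕ} {x : R} (h : CommProd n x) (s : R) : CommProd n (s * x) := by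
  cases h with
  | base r => exact .base _
  | cons r ha hx => rw [← mul_assoc, ← mul_assoc]; exact .cons _ ha hx

lemma CommProd.mul_right {n : ℕ} {x : R} (h : CommProd n x) (s : R) : CommProd n (x * s) := by
  induction h with
  | base r => exact .base _
  | cons r ha hx ih => rw [mul_assoc]; exact .cons _ ha ih

lemma CommProd.mul {n m : ℕ} {x y : R} (h : CommProd n x) (h' : CommProd m y) :
    CommProd (n + m) (x * y) := by
  induction h with
  | base r => simpa using h'.mul_left r
  | cons r ha hx ih => rw [mul_assoc, add_assoc]; exact .cons _ ha ih

lemma CommProd.mem_commSet {n : ℕ} {x : R} (h : CommProd n x) {n' : ℕ} (hn : n' ≤ n) :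
    x ∈ commSet R n' := by
  suffices x ∈ commSet R n by
    obtain ⟨m, i, r, a, h1, h2, h3, h4⟩ := this
    exact ⟨m, i, r, a, h1, hn.trans h2, h3, h4⟩
  clear hn
  induction h with
  | base r => exact ⟨0, Fin.elim0, fun _ => r, Fin.elim0, by simp, by simp, by simp, by simp⟩
  | @cons n x r a k ha hx ih =>
    obtain ⟨m, i, s, b, h1, h2, h3, h4⟩ := ih
    refine ⟨m + 1, Fin.cons (k + 2) i, Fin.cons r s, Fin.cons a b, ?_, ?_, ?_, ?_⟩
    · intro j; refine Fin.cases ?_ ?_ j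
      · simp
      · simpa using h1
    · simp [Fin.sum_univ_succ, h2]
    · intro j; refine Fin.cases ?_ ?_ j
      · simpa using ha
      · simpa using h3
    · simp [List.ofFn_succ, h4, mul_assoc]

lemma exists_commProd_of_mem_commSet {n : ℕ} {x : R} (h : x ∈ commSet R n) :
    ∃ n', n ≤ n' ∧ CommProd n' x := by
  obtain ⟨m, i, r, a, h1, h2, h3, h4⟩ := h
  refine ⟨_, h2, ?_⟩
  clear h2 n
  induction m generalizing x with
  | zero => simpa using CommProd.base x
  | succ m ih =>
    have := ih (fun k => i k.succ) (fun k => r k.succ) (fun k => a k.succ) (fun k => h1 _)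
      (fun k => h3 _) rfl
    have h30 := h3 0
    obtain ⟨j, hj⟩ : ∃ j, i 0 = j + 2 := ⟨i 0 - 2, by have := h1 0; omega⟩
    rw [hj] at h30
    have h5 := CommProd.cons (r 0) (k := j) h30 this
    rw [Fin.sum_univ_succ, hj, h4]
    simpa [List.ofFn_succ, mul_assoc] using h5

lemma commProd_mem {n n' : ℕ} {x : R} (h : CommProd n' x) (hn : n ≤ n') :
    x ∈ commFiltration R n :=
  TwoSidedIdeal.subset_span (h.mem_commSet hn)

lemma commFiltration_induction {n : ℕ} {P : R → Prop}
    (h : ∀ n' x, n ≤ n' → CommProd n' x → P x) (h0 : P 0) (hadd : ∀ x y, P x → P y → P (x + y))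
    (hneg : ∀ x, P x → P (-x)) {x : R} (hx : x ∈ commFiltration R n) : P x := by
  have : x ∈ AddSubgroup.closure {x : R | ∃ n', n ≤ n' ∧ CommProd n' x} := by
    let J : TwoSidedIdeal R := TwoSidedIdeal.mk'
      (AddSubgroup.closure {x : R | ∃ n', n ≤ n' ∧ CommProd n' x} : Set R)
      (zero_mem _) (fun h h' => add_mem h h') (fun h => neg_mem h)
      (fun {r x} hx => by
        change x ∈ AddSubgroup.closure _ at hx
        change r * x ∈ AddSubgroup.closure _
        induction hx using AddSubgroup.closure_induction with
        | mem x hx => obtain ⟨n', h1, h2⟩ := hx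
                      exact AddSubgroup.subset_closure ⟨n', h1, h2.mul_left r⟩
        | zero => simp
        | add x y _ _ h1 h2 => rw [mul_add]; exact add_mem h1 h2
        | neg x _ h1 => rw [mul_neg]; exact neg_mem h1)
      (fun {x r} hx => by
        change x ∈ AddSubgroup.closure _ at hx
        change x * r ∈ AddSubgroup.closure _
        induction hx using AddSubgroup.closure_induction with
        | mem x hx => obtain ⟨n', h1, h2⟩ := hx
                      exact AddSubgroup.subset_closure ⟨n', h1, h2.mul_right r⟩
        | zero => simp
        | add x y _ _ h1 h2 => rw [add_mul]; exact add_mem h1 h2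
        | neg x _ h1 => rw [neg_mul]; exact neg_mem h1)
    have hle : commFiltration R n ≤ J := TwoSidedIdeal.span_le.2 fun y hy => by
      have : y ∈ AddSubgroup.closure {x : R | ∃ n', n ≤ n' ∧ CommProd n' x} :=
        AddSubgroup.subset_closure (exists_commProd_of_mem_commSet hy)
      simpa [J] using this
    simpa [J] using hle hx
  clear hx
  induction this using AddSubgroup.closure_induction with
  | mem x hx => obtain ⟨n', h1, h2⟩ := hx; exact h n' x h1 h2
  | zero => exact h0
  | add x y _ _ h1 h2 => exact hadd x y h1 h2
  | neg x _ h1 => exact hneg x h1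

lemma twoSidedIdeal_smul_mem (K : TwoSidedIdeal R) (c : ℂ) {x : R} (hx : x ∈ K) : c • x ∈ K := by
  rw [Algebra.smul_def]; exact K.mul_mem_left _ _ hx

lemma commFiltration_antitone : Antitone (commFiltration R) := fun n _ hnm _ hx =>
  commFiltration_induction (P := fun x => x ∈ commFiltration R n)
    (fun _ _ h1 h2 => commProd_mem h2 (hnm.trans h1)) (zero_mem _)
    (fun _ _ h h' => add_mem h h') (fun _ h => neg_mem h) hx

lemma mem_commFiltration_zero (x : R) : x ∈ commFiltration R 0 :=
  commProd_mem (.base x) le_rfl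

lemma commFiltration_mul_mem {n m : ℕ} {x y : R} (hx : x ∈ commFiltration R n)
    (hy : y ∈ commFiltration R m) : x * y ∈ commFiltration R (n + m) := by
  refine commFiltration_induction (P := fun x => x * y ∈ commFiltration R (n + m)) ?_ ?_ ?_ ?_ hx
  · intro n' x hn hx
    refine commFiltration_induction (P := fun y => x * y ∈ commFiltration R (n + m))
      ?_ ?_ ?_ ?_ hy
    · intro m' y hm hy
      exact commProd_mem (hx.mul hy) (by omega)
    · simp
    · intro x y h h'; rw [mul_add]; exact add_mem h h'
    · intro x h; rw [mul_neg]; exact neg_mem h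
  · simp
  · intro x y h h'; rw [add_mul]; exact add_mem h h'
  · intro x h; rw [neg_mul]; exact neg_mem h

lemma lieLCS_mem {k : ℕ} {x : R} (hx : x ∈ lieLCS R (k + 1)) : x ∈ commFiltration R (k + 2) := by
  have := CommProd.cons 1 hx (.base 1)
  simp only [one_mul, mul_one] at this
  exact commProd_mem this (by omega)

lemma commutator_mem_lieLCS {k : ℕ} {x : R} (hx : x ∈ lieLCS R k) (y : R) :
    x * y - y * x ∈ lieLCS R (k + 1) :=
  Submodule.subset_span ⟨x, hx, y, rfl⟩

lemma commutator_mem_two (x y : R) : x * y - y * x ∈ commFiltration R 2 :=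
  lieLCS_mem (k := 0) (commutator_mem_lieLCS (k := 0) (by simp [lieLCS]) y)

lemma commutator_mem_succ {n : ℕ} {x : R} (hx : x ∈ commFiltration R n) (y : R) :
    x * y - y * x ∈ commFiltration R (n + 1) := by
  refine commFiltration_induction (P := fun x => x * y - y * x ∈ commFiltration R (n + 1))
    ?_ ?_ ?_ ?_ hx
  · intro n' x hn hx
    refine commFiltration_antitone (Nat.succ_le_succ hn) ?_
    clear hn
    induction hx with
    | base r => exact commFiltration_antitone (by omega) (commutator_mem_two r y)
    | @cons n x r a k ha hx ih =>
      have e : r * a * x * y - y * (r * a * x) = (r * y - y * r) * (a * x)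
        + r * ((a * y - y * a) * x) + r * (a * (x * y - y * x)) := by noncomm_ring
      rw [e]
      refine add_mem (add_mem ?_ (TwoSidedIdeal.mul_mem_left _ _ _ ?_))
        (TwoSidedIdeal.mul_mem_left _ _ _ ?_)
      · refine commFiltration_antitone ?_ (commFiltration_mul_mem (commutator_mem_two r y)
          (commFiltration_mul_mem (lieLCS_mem ha) (commProd_mem hx le_rfl)))
        omega
      · refine commFiltration_antitone ?_ (commFiltration_mul_mem
          (lieLCS_mem (commutator_mem_lieLCS ha y)) (commProd_mem hx le_rfl))
        omega
      · refine commFiltration_antitone ?_ (commFiltration_mul_mem (lieLCS_mem ha) ih)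
        omega
  · simp
  · intro x z h h'
    have e : (x + z) * y - y * (x + z) = (x * y - y * x) + (z * y - y * z) := by noncomm_ring
    rw [e]; exact add_mem h h'
  · intro x h
    have e : -x * y - y * -x = -(x * y - y * x) := by noncomm_ring
    rw [e]; exact neg_mem h

/-- `commFiltration` is the smallest multiplicative filtration by two-sided ideals with
`[R, R] ⊆ K 2` and `[K i, R] ⊆ K (i + 1)` for `i ≥ 2`. -/
lemma commFiltration_le (K : ℕ → TwoSidedIdeal R) (hanti : Antitone K)
    (h0 : ∀ x, x ∈ K 0) (hmul : ∀ i j x y, x ∈ K i → y ∈ K j → x * y ∈ K (i + j))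
    (h2 : ∀ x y, x * y - y * x ∈ K 2)
    (hc : ∀ i, 2 ≤ i → ∀ x ∈ K i, ∀ y, x * y - y * x ∈ K (i + 1))
    {n : ℕ} {x : R} (hx : x ∈ commFiltration R n) : x ∈ K n := by
  have hl : ∀ k, ∀ x ∈ lieLCS R (k + 1), x ∈ K (k + 2) := by
    intro k
    induction k with
    | zero =>
      intro x hx
      refine Submodule.span_induction (p := fun x _ => x ∈ K 2) ?_ (zero_mem _)
        (fun _ _ _ _ h h' => add_mem h h') (fun c _ _ h => twoSidedIdeal_smul_mem _ c h) hx
      rintro _ ⟨a, _, b, rfl⟩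
      exact h2 a b
    | succ k ih =>
      intro x hx
      refine Submodule.span_induction (p := fun x _ => x ∈ K (k + 1 + 2)) ?_ (zero_mem _)
        (fun _ _ _ _ h h' => add_mem h h') (fun c _ _ h => twoSidedIdeal_smul_mem _ c h) hx
      rintro _ ⟨a, ha, b, rfl⟩
      exact hc (k + 2) (by omega) a (ih a ha) b
  refine commFiltration_induction (P := fun x => x ∈ K n) ?_ (zero_mem _)
    (fun _ _ h h' => add_mem h h') (fun _ h => neg_mem h) hx
  intro n' x hn hx
  refine hanti hn ?_
  clear hn
  induction hx with
  | base r => exact h0 r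
  | cons r ha hx ih =>
    rw [mul_assoc]
    exact (K _).mul_mem_left _ _ (hmul _ _ _ _ (hl _ _ ha) ih)

lemma commFiltration_map {S : Type} [Ring S] [Algebra ℂ S] (f : R →ₐ[ℂ] S) {n : ℕ} {x : R}
    (hx : x ∈ commFiltration R n) : f x ∈ commFiltration S n := by
  have := commFiltration_le (fun n => (commFiltration S n).comap f)
    (fun n m h x hx => by
      rw [TwoSidedIdeal.mem_comap] at hx ⊢; exact commFiltration_antitone h hx)
    (fun x => by rw [TwoSidedIdeal.mem_comap]; exact mem_commFiltration_zero _)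
    (fun i j x y hx hy => by
      rw [TwoSidedIdeal.mem_comap] at hx hy ⊢
      rw [map_mul]; exact commFiltration_mul_mem hx hy)
    (fun x y => by
      rw [TwoSidedIdeal.mem_comap, map_sub, map_mul, map_mul]; exact commutator_mem_two _ _)
    (fun i _ x hx y => by
      rw [TwoSidedIdeal.mem_comap] at hx ⊢
      rw [map_sub, map_mul, map_mul]; exact commutator_mem_succ hx _) hx
  simpa only [TwoSidedIdeal.mem_comap] using this

lemma exists_lieLCS_of_surjective {S : Type} [Ring S] [Algebra ℂ S] {f : R →ₐ[ℂ] S}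
    (hf : Function.Surjective f) (k : ℕ) {y : S} (hy : y ∈ lieLCS S k) :
    ∃ x ∈ lieLCS R k, f x = y := by
  induction k generalizing y with
  | zero => obtain ⟨x, rfl⟩ := hf y; exact ⟨x, by simp [lieLCS], rfl⟩
  | succ k ih =>
    refine Submodule.span_induction (p := fun y _ => ∃ x ∈ lieLCS R (k + 1), f x = y)
      ?_ ⟨0, zero_mem _, map_zero f⟩ ?_ ?_ hy
    · rintro _ ⟨a, ha, b, rfl⟩
      obtain ⟨a, ha', rfl⟩ := ih ha
      obtain ⟨b, rfl⟩ := hf b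
      exact ⟨_, commutator_mem_lieLCS ha' b, by simp⟩
    · rintro _ _ _ _ ⟨a, ha, rfl⟩ ⟨b, hb, rfl⟩
      exact ⟨a + b, add_mem ha hb, map_add f a b⟩
    · rintro c _ _ ⟨a, ha, rfl⟩
      exact ⟨c • a, Submodule.smul_mem _ c ha, map_smul f c a⟩

lemma exists_commFiltration_of_surjective {S : Type} [Ring S] [Algebra ℂ S] {f : R →ₐ[ℂ] S}
    (hf : Function.Surjective f) {n : ℕ} {y : S} (hy : y ∈ commFiltration S n) :
    ∃ x ∈ commFiltration R n, f x = y := by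
  refine commFiltration_induction (P := fun y => ∃ x ∈ commFiltration R n, f x = y)
    ?_ ⟨0, zero_mem _, map_zero f⟩ ?_ ?_ hy
  · intro n' y hn hy
    suffices ∃ x, CommProd n' x ∧ f x = y by
      obtain ⟨x, hx, h⟩ := this
      exact ⟨x, commProd_mem hx hn, h⟩
    clear hn
    induction hy with
    | base r => obtain ⟨r, rfl⟩ := hf r; exact ⟨r, .base r, rfl⟩
    | cons r ha hx ih =>
      obtain ⟨r, rfl⟩ := hf r
      obtain ⟨a, ha', rfl⟩ := exists_lieLCS_of_surjective hf _ ha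
      obtain ⟨x, hx', rfl⟩ := ih
      exact ⟨_, .cons r ha' hx', by simp⟩
  · rintro _ _ ⟨a, ha, rfl⟩ ⟨b, hb, rfl⟩
    exact ⟨a + b, add_mem ha hb, map_add f a b⟩
  · rintro _ ⟨a, ha, rfl⟩
    exact ⟨-a, neg_mem ha, map_neg f a⟩

end Filtration

section LowOrder

variable {T : Type} [Ring T]

open Polynomial

/-- `p` is divisible by `X ^ m`. -/
def Low (m : ℕ) (p : T[X]) : Prop := ∀ i < m, p.coeff i = 0

lemma Low.mono {m n : ℕ} (h : n ≤ m) {p : T[X]} (hp : Low m p) : Low n p :=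
  fun i hi => hp i (hi.trans_le h)

lemma low_zero (m : ℕ) : Low m (0 : T[X]) := fun _ _ => coeff_zero _

lemma Low.add {m : ℕ} {p q : T[X]} (hp : Low m p) (hq : Low m q) : Low m (p + q) :=
  fun i hi => by rw [coeff_add, hp i hi, hq i hi, add_zero]

lemma Low.neg {m : ℕ} {p : T[X]} (hp : Low m p) : Low m (-p) :=
  fun i hi => by rw [coeff_neg, hp i hi, neg_zero]

lemma Low.sub {m : ℕ} {p q : T[X]} (hp : Low m p) (hq : Low m q) : Low m (p - q) := by
  rw [sub_eq_add_neg]; exact hp.add hq.neg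

lemma Low.mul {m n : ℕ} {p q : T[X]} (hp : Low m p) (hq : Low n q) : Low (m + n) (p * q) := by
  intro i hi
  rw [coeff_mul]
  refine Finset.sum_eq_zero fun x hx => ?_
  rw [Finset.HasAntidiagonal.mem_antidiagonal] at hx
  by_cases h : x.1 < m
  · rw [hp _ h, zero_mul]
  · rw [hq x.2 (by omega), mul_zero]

lemma Low.coeff_mul {m n : ℕ} {p q : T[X]} (hp : Low m p) (hq : Low n q) :
    (p * q).coeff (m + n) = p.coeff m * q.coeff n := by
  rw [Polynomial.coeff_mul]
  refine Finset.sum_eq_single (m, n) ?_ (by simp)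
  rintro ⟨i, j⟩ hij hne
  rw [Finset.HasAntidiagonal.mem_antidiagonal] at hij
  simp only at hij ⊢
  by_cases h : i < m
  · rw [hp _ h, zero_mul]
  · rw [hq j ?_, mul_zero]
    rcases lt_or_ge j n with h' | h'
    · exact h'
    · exact absurd (by ext <;> simp <;> omega) hne

lemma low_zero_left (p : T[X]) : Low 0 p := fun _ h => absurd h (Nat.not_lt_zero _)

lemma Low.commutator {m : ℕ} {p q : T[X]} (hp : Low m p) (hq : ∀ t, q.coeff 0 * t = t * q.coeff 0) :
    Low (m + 1) (p * q - q * p) := by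
  intro i hi
  rcases Nat.lt_succ_iff_lt_or_eq.1 hi with h | rfl
  · exact ((hp.mul (low_zero_left q)).sub
      (((low_zero_left q).mul hp).mono (by simp))) i h
  · have h1 := hp.coeff_mul (low_zero_left q)
    have h2 := (low_zero_left q).coeff_mul hp
    rw [add_zero] at h1
    rw [zero_add] at h2
    rw [coeff_sub, h1, h2, hq, sub_self]

/-- The two-sided ideal of polynomials divisible by `X ^ m`. -/
def lowIdeal (T : Type) [Ring T] (m : ℕ) : TwoSidedIdeal T[X] :=
  TwoSidedIdeal.mk' {p | Low m p} (low_zero m) (fun h h' => h.add h') (fun h => h.neg)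
    (fun {x _} hy => (((low_zero_left x).mul hy).mono (by simp)))
    (fun {_ y} hx => hx.mul (low_zero_left y))

lemma mem_lowIdeal {m : ℕ} {p : T[X]} : p ∈ lowIdeal T m ↔ Low m p := by
  simp [lowIdeal]

variable [Algebra ℂ T] {P : Type} [Ring P] [Algebra ℂ P]

lemma low_of_mem_commFiltration (α : P →ₐ[ℂ] T[X])
    (hα : ∀ x t, (α x).coeff 0 * t = t * (α x).coeff 0)
    {m : ℕ} {x : P} (hx : x ∈ commFiltration P m) : Low m (α x) := by
  have := commFiltration_le (fun m => (lowIdeal T m).comap α)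
    (fun n m h x hx => by
      rw [TwoSidedIdeal.mem_comap, mem_lowIdeal] at hx ⊢; exact hx.mono h)
    (fun x => by rw [TwoSidedIdeal.mem_comap, mem_lowIdeal]; exact low_zero_left _)
    (fun i j x y hx hy => by
      rw [TwoSidedIdeal.mem_comap, mem_lowIdeal] at hx hy ⊢
      rw [map_mul]; exact hx.mul hy)
    (fun x y => by
      rw [TwoSidedIdeal.mem_comap, mem_lowIdeal, map_sub, map_mul, map_mul]
      intro i hi
      rcases (by omega : i = 0 ∨ i = 1) with rfl | rfl
      · rw [coeff_sub, mul_coeff_zero, mul_coeff_zero, hα, sub_self]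
      · rw [coeff_sub, mul_coeff_one, mul_coeff_one, hα, ← hα y]; abel)
    (fun i _ x hx y => by
      rw [TwoSidedIdeal.mem_comap, mem_lowIdeal] at hx ⊢
      rw [map_sub, map_mul, map_mul]; exact hx.commutator (hα y)) hx
  simpa only [TwoSidedIdeal.mem_comap, mem_lowIdeal] using this

lemma low_sub_of_mem_commFiltration (α β : P →ₐ[ℂ] T[X])
    (hα : ∀ x t, (α x).coeff 0 * t = t * (α x).coeff 0)
    (hβ : ∀ x t, (β x).coeff 0 * t = t * (β x).coeff 0)
    (h : ∀ x, Low 2 (α x - β x))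
    {m : ℕ} {x : P} (hm : 2 ≤ m) (hx : x ∈ commFiltration P m) : Low (m + 1) (α x - β x) := by
  have hI := fun {m : ℕ} {x : P} (hx : x ∈ commFiltration P m) =>
    And.intro (low_of_mem_commFiltration α hα hx) (low_of_mem_commFiltration β hβ hx)
  have hmulsub : ∀ x y, α (x * y) - β (x * y) = (α x - β x) * α y + β x * (α y - β y) := by
    intro x y
    rw [map_mul, map_mul]; noncomm_ring
  let J : ℕ → TwoSidedIdeal P := fun m =>
    TwoSidedIdeal.mk' {x | x ∈ commFiltration P m ∧ Low (m + 1) (α x - β x)}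
    ⟨zero_mem _, by simp [low_zero]⟩
    (fun h h' => ⟨add_mem h.1 h'.1, by rw [map_add, map_add, add_sub_add_comm]; exact h.2.add h'.2⟩)
    (fun h => ⟨neg_mem h.1, by rw [map_neg, map_neg, neg_sub_neg, ← neg_sub]; exact h.2.neg⟩)
    (fun {x y} hy => ⟨TwoSidedIdeal.mul_mem_left _ _ _ hy.1, by
      rw [hmulsub]
      exact (((h x).mul (hI hy.1).1).mono (by omega)).add
        (((low_zero_left _).mul hy.2).mono (by omega))⟩)
    (fun {x y} hx => ⟨TwoSidedIdeal.mul_mem_right _ _ _ hx.1, by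
      rw [hmulsub]
      exact ((hx.2.mul (low_zero_left _))).add
        (((hI hx.1).2.mul (h y)).mono (by omega))⟩)
  have hJ : ∀ m x, x ∈ J m ↔ x ∈ commFiltration P m ∧ Low (m + 1) (α x - β x) := by
    intro m x
    simp only [J, TwoSidedIdeal.mem_mk', Set.mem_ofPred_eq]
  have hJanti : Antitone J := fun i j hij x hx => by
    rw [hJ] at hx ⊢
    exact ⟨commFiltration_antitone hij hx.1, hx.2.mono (by omega)⟩
  let K : ℕ → TwoSidedIdeal P := fun m => if m = 0 then ⊤ else J (max m 2)
  have hK0 : ∀ x, x ∈ K 0 := fun x => by simp only [K, if_pos]; trivial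
  have hK : ∀ m, m ≠ 0 → K m = J (max m 2) := fun m hm => if_neg hm
  have key : x ∈ K m := by
    refine commFiltration_le K ?_ hK0 ?_ ?_ ?_ hx
    · intro i j hij
      rcases eq_or_ne i 0 with rfl | hi
      · exact fun x _ => hK0 x
      · rw [hK i hi, hK j (by omega)]
        exact hJanti (by omega)
    · intro i j x y hx hy
      rcases eq_or_ne i 0 with rfl | hi
      · rw [zero_add]; exact (K j).mul_mem_left _ _ hy
      rcases eq_or_ne j 0 with rfl | hj
      · exact (K i).mul_mem_right _ _ hx
      rw [hK _ hi, hJ] at hx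
      rw [hK _ hj, hJ] at hy
      rw [hK _ (by omega)]
      refine hJanti (?_ : max (i + j) 2 ≤ max i 2 + max j 2) ((hJ _ _).2 ?_)
      · omega
      · refine ⟨commFiltration_mul_mem hx.1 hy.1, ?_⟩
        rw [hmulsub]
        exact ((hx.2.mul (hI hy.1).1).mono (by omega)).add
          (((hI hx.1).2.mul hy.2).mono (by omega))
    · intro x y
      rw [hK 2 (by norm_num), hJ]
      refine ⟨commutator_mem_two x y, ?_⟩
      have e : α (x * y - y * x) - β (x * y - y * x) = ((α x - β x) * α y - α y * (α x - β x))
        - ((α y - β y) * β x - β x * (α y - β y)) := by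
          rw [map_sub, map_sub, map_mul, map_mul, map_mul, map_mul]; noncomm_ring
      rw [e]
      exact ((h x).commutator (hα y)).sub ((h y).commutator (hβ x))
    · intro i hi x hx y
      rw [hK _ (by omega), hJ] at hx
      rw [hK _ (by omega)]
      refine hJanti (?_ : max (i + 1) 2 ≤ max i 2 + 1) ((hJ _ _).2 ?_)
      · omega
      refine ⟨commutator_mem_succ hx.1 y, ?_⟩
      have e : α (x * y - y * x) - β (x * y - y * x) = ((α x - β x) * α y - α y * (α x - β x))
        + (β x * (α y - β y) - (α y - β y) * β x) := by
          rw [map_sub, map_sub, map_mul, map_mul, map_mul, map_mul]; noncomm_ring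
      rw [e]
      refine (hx.2.commutator (hα y)).add ?_
      have hb := (hI hx.1).2
      exact (((hb.mul (h y)).sub (((h y).mul hb).mono (by omega))).mono (by omega))
  rw [hK m (by omega), hJ, max_eq_left hm] at key
  exact key.2

end LowOrder

section Brackets

variable {X B : Type} [Ring B]

/-- Left-normed iterated commutators of `n ≥ 2` generators. -/
inductive IsBr (v : X → B) : ℕ → B → Prop
  | two (x y : X) : IsBr v 2 (v x * v y - v y * v x)
  | succ {n : ℕ} {b : B} (h : IsBr v n b) (x : X) : IsBr v (n + 1) (b * v x - v x * b)

/-- Products of left-normed iterated commutators and of generators from `L`, of total degree `n`. -/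
inductive BrProd (v : X → B) (L : Set X) : ℕ → B → Prop
  | one : BrProd v L 0 1
  | letter {n : ℕ} {t : B} (h : BrProd v L n t) {x : X} (hx : x ∈ L) : BrProd v L (n + 1) (t * v x)
  | mul {n m : ℕ} {t b : B} (h : BrProd v L n t) (hb : IsBr v m b) : BrProd v L (n + m) (t * b)

lemma BrProd.mul_brProd {v : X → B} {L : Set X} {n m : ℕ} {s t : B} (hs : BrProd v L n s)
    (ht : BrProd v L m t) : BrProd v L (n + m) (s * t) := by
  induction ht with
  | one => simpa using hs
  | letter h hx ih => rw [← mul_assoc, ← add_assoc]; exact ih.letter hx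
  | mul h hb ih => rw [← mul_assoc, ← add_assoc]; exact ih.mul hb

lemma IsBr.map {C : Type} [Ring C] (f : B →+* C) {v : X → B} {n : ℕ} {b : B} (h : IsBr v n b) :
    IsBr (fun x => f (v x)) n (f b) := by
  induction h with
  | two x y => rw [map_sub, map_mul, map_mul]; exact .two x y
  | succ h x ih => rw [map_sub, map_mul, map_mul]; exact .succ ih x

lemma BrProd.map {C : Type} [Ring C] (f : B →+* C) {v : X → B} {L : Set X} {n : ℕ} {b : B}
    (h : BrProd v L n b) : BrProd (fun x => f (v x)) L n (f b) := by
  induction h with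
  | one => rw [map_one]; exact .one
  | letter h hx ih => rw [map_mul]; exact ih.letter hx
  | mul h hb ih => rw [map_mul]; exact ih.mul (hb.map f)

lemma IsBr.exists_of_map {C : Type} [Ring C] (f : B →+* C) {v : X → B} {n : ℕ} {c : C}
    (h : IsBr (fun x => f (v x)) n c) : ∃ b, IsBr v n b ∧ f b = c := by
  induction h with
  | two x y => exact ⟨_, .two x y, by rw [map_sub, map_mul, map_mul]⟩
  | succ h x ih =>
    obtain ⟨b, hb, rfl⟩ := ih
    exact ⟨_, .succ hb x, by rw [map_sub, map_mul, map_mul]⟩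

lemma BrProd.exists_of_map {C : Type} [Ring C] (f : B →+* C) {v : X → B} {L : Set X} {n : ℕ} {c : C}
    (h : BrProd (fun x => f (v x)) L n c) : ∃ b, BrProd v L n b ∧ f b = c := by
  induction h with
  | one => exact ⟨1, .one, map_one f⟩
  | letter h hx ih =>
    obtain ⟨b, hb, rfl⟩ := ih
    exact ⟨_, hb.letter hx, map_mul _ _ _⟩
  | mul h h2 ih =>
    obtain ⟨b, hb, rfl⟩ := ih
    obtain ⟨b', hb', rfl⟩ := IsBr.exists_of_map f h2
    exact ⟨_, hb.mul hb', map_mul _ _ _⟩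

lemma IsBr.mem_commFiltration [Algebra ℂ B] {v : X → B} {n : ℕ} {b : B} (h : IsBr v n b) :
    b ∈ commFiltration B n := by
  induction h with
  | two x y => exact commutator_mem_two _ _
  | succ h x ih => exact commutator_mem_succ ih _

lemma BrProd.mem_commFiltration [Algebra ℂ B] {v : X → B} {n : ℕ} {b : B}
    (h : BrProd v ∅ n b) : b ∈ commFiltration B n := by
  induction h with
  | one => exact mem_commFiltration_zero _
  | letter h hx ih => exact absurd hx (Set.notMem_empty _)
  | mul h hb ih => exact commFiltration_mul_mem ih hb.mem_commFiltration

/-- Commuting a bracket product past a generator raises the degree. -/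
lemma BrProd.commutator {v : X → B} {L : Set X} {n : ℕ} {w : B} (h : BrProd v L n w) (x : X) :
    w * v x - v x * w ∈ AddSubgroup.closure {y | BrProd v L (n + 1) y} := by
  induction h with
  | one => simp
  | @letter n t h y hy ih =>
    have e : t * v y * v x - v x * (t * v y)
        = t * (v y * v x - v x * v y) + (t * v x - v x * t) * v y := by noncomm_ring
    rw [e]
    refine add_mem (AddSubgroup.subset_closure (h.mul (.two y x))) ?_
    clear e h
    generalize t * v x - v x * t = z at ih
    induction ih using AddSubgroup.closure_induction with
    | mem z hz => exact AddSubgroup.subset_closure (hz.letter hy)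
    | zero => simp
    | add y z _ _ h1 h2 => rw [add_mul]; exact add_mem h1 h2
    | neg y _ h1 => rw [neg_mul]; exact neg_mem h1
  | @mul n m t b h hb ih =>
    have e : t * b * v x - v x * (t * b) = t * (b * v x - v x * b) + (t * v x - v x * t) * b := by
      noncomm_ring
    rw [e]
    refine add_mem (AddSubgroup.subset_closure (h.mul (hb.succ x))) ?_
    clear e h
    generalize t * v x - v x * t = z at ih
    induction ih using AddSubgroup.closure_induction with
    | mem y hy =>
      refine AddSubgroup.subset_closure ?_
      have := BrProd.mul (m := m) hy hb
      rwa [add_right_comm] at this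
    | zero => simp
    | add y z _ _ h1 h2 => rw [add_mul]; exact add_mem h1 h2
    | neg y _ h1 => rw [neg_mul]; exact neg_mem h1

/-- Additive span of left multiples of bracket products of degree at least `m`. -/
def brSpan (v : X → B) (m : ℕ) : AddSubgroup B :=
  AddSubgroup.closure {y | ∃ j, m ≤ j ∧ ∃ g w, BrProd v ∅ j w ∧ y = g * w}

lemma brSpan_antitone (v : X → B) : Antitone (brSpan v) := fun _ _ h =>
  AddSubgroup.closure_mono (by rintro _ ⟨j, hj, g, w, hw, rfl⟩; exact ⟨j, h.trans hj, g, w, hw, rfl⟩)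

lemma mem_brSpan {v : X → B} {m : ℕ} {w : B} (h : BrProd v ∅ m w) (g : B) : g * w ∈ brSpan v m :=
  AddSubgroup.subset_closure ⟨m, le_rfl, g, w, h, rfl⟩

lemma brSpan_mul_left {v : X → B} {m : ℕ} {y : B} (g : B) (hy : y ∈ brSpan v m) :
    g * y ∈ brSpan v m := by
  induction hy using AddSubgroup.closure_induction with
  | mem y hy =>
    obtain ⟨j, hj, g', w, hw, rfl⟩ := hy
    rw [← mul_assoc]
    exact brSpan_antitone v hj (mem_brSpan hw _)
  | zero => simp
  | add y z _ _ h1 h2 => rw [mul_add]; exact add_mem h1 h2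
  | neg y _ h1 => rw [mul_neg]; exact neg_mem h1

lemma brSpan_of_closure {v : X → B} {m : ℕ} {y : B}
    (h : y ∈ AddSubgroup.closure {y | BrProd v ∅ m y}) : y ∈ brSpan v m := by
  refine (AddSubgroup.closure_le (brSpan v m)).2 (fun y hy => ?_) h
  have := mem_brSpan (v := v) (m := m) (w := y) hy 1
  rwa [one_mul] at this

end Brackets

section FreeBrackets

variable {X : Type}

open FreeAlgebra

lemma brSpan_mul_right {m : ℕ} {y : FreeAlgebra ℂ X} (f : FreeAlgebra ℂ X)
    (hy : y ∈ brSpan (ι ℂ : X → FreeAlgebra ℂ X) m) : y * f ∈ brSpan (ι ℂ) m := by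
  induction f using FreeAlgebra.induction generalizing y with
  | grade0 r => rw [← Algebra.commutes]; exact brSpan_mul_left _ hy
  | grade1 x =>
    induction hy using AddSubgroup.closure_induction with
    | mem y hy =>
      obtain ⟨j, hj, g, w, hw, rfl⟩ := hy
      have e : g * w * ι ℂ x = g * ι ℂ x * w + g * (w * ι ℂ x - ι ℂ x * w) := by noncomm_ring
      rw [e]
      refine add_mem (brSpan_antitone _ hj (mem_brSpan hw _))
        (brSpan_antitone _ (by omega : m ≤ j + 1) ?_)
      exact brSpan_mul_left _ (brSpan_of_closure (hw.commutator x))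
    | zero => simp
    | add y z _ _ h1 h2 => rw [add_mul]; exact add_mem h1 h2
    | neg y _ h1 => rw [neg_mul]; exact neg_mem h1
  | mul a b iha ihb => rw [← mul_assoc]; exact ihb (iha hy)
  | add a b iha ihb => rw [mul_add]; exact add_mem (iha hy) (ihb hy)

/-- `brSpan` as a two-sided ideal of the free algebra. -/
def brIdeal (X : Type) (m : ℕ) : TwoSidedIdeal (FreeAlgebra ℂ X) :=
  TwoSidedIdeal.mk' {y | y ∈ brSpan (ι ℂ : X → FreeAlgebra ℂ X) m}
    (brSpan (ι ℂ) m).zero_mem (fun h h' => (brSpan (ι ℂ) m).add_mem h h')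
    (fun h => (brSpan (ι ℂ) m).neg_mem h) (fun h => brSpan_mul_left _ h)
    (fun h => brSpan_mul_right _ h)

lemma mem_brIdeal {m : ℕ} {y : FreeAlgebra ℂ X} : y ∈ brIdeal X m ↔ y ∈ brSpan (ι ℂ) m := by
  simp [brIdeal]

/-- An ideal containing the commutators of `a` with the generators contains all commutators. -/
lemma commutator_mem_of_forall_ι (K : TwoSidedIdeal (FreeAlgebra ℂ X)) (a : FreeAlgebra ℂ X)
    (h : ∀ x, a * ι ℂ x - ι ℂ x * a ∈ K) (f : FreeAlgebra ℂ X) : a * f - f * a ∈ K := by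
  induction f using FreeAlgebra.induction with
  | grade0 r => rw [← Algebra.commutes, sub_self]; exact zero_mem _
  | grade1 x => exact h x
  | mul f g ihf ihg =>
    have e : a * (f * g) - f * g * a = (a * f - f * a) * g + f * (a * g - g * a) := by noncomm_ring
    rw [e]
    exact add_mem (K.mul_mem_right _ _ ihf) (K.mul_mem_left _ _ ihg)
  | add f g ihf ihg =>
    have e : a * (f + g) - (f + g) * a = (a * f - f * a) + (a * g - g * a) := by noncomm_ring
    rw [e]; exact add_mem ihf ihg

lemma mem_brSpan_of_mem_commFiltration {m : ℕ} {f : FreeAlgebra ℂ X}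
    (hf : f ∈ commFiltration (FreeAlgebra ℂ X) m) : f ∈ brSpan (ι ℂ) m := by
  have hmul : ∀ i j x y, x ∈ brIdeal X i → y ∈ brIdeal X j → x * y ∈ brIdeal X (i + j) := by
    intro i j x y hx hy
    rw [mem_brIdeal] at hx hy
    induction hy using AddSubgroup.closure_induction with
    | mem y hy =>
      obtain ⟨j', hj, g', w', hw', rfl⟩ := hy
      have hx' := brSpan_mul_right g' hx
      rw [← mul_assoc]
      generalize x * g' = z at hx'
      induction hx' using AddSubgroup.closure_induction with
      | mem y hy =>
        obtain ⟨i', hi, g, w, hw, rfl⟩ := hy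
        rw [mul_assoc, mem_brIdeal]
        exact brSpan_antitone _ (by omega) (mem_brSpan (hw.mul_brProd hw') g)
      | zero => rw [zero_mul]; exact zero_mem _
      | add y z _ _ h1 h2 => rw [add_mul]; exact add_mem h1 h2
      | neg y _ h1 => rw [neg_mul]; exact neg_mem h1
    | zero => rw [mul_zero]; exact zero_mem _
    | add y z _ _ h1 h2 => rw [mul_add]; exact add_mem h1 h2
    | neg y _ h1 => rw [mul_neg]; exact neg_mem h1
  have hanti : Antitone (brIdeal X) := fun i j h x hx => by
    rw [mem_brIdeal] at hx ⊢; exact brSpan_antitone _ h hx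
  have h2 : ∀ x y, x * y - y * x ∈ brIdeal X 2 := by
    intro x y
    refine commutator_mem_of_forall_ι _ _ (fun b => ?_) y
    rw [← neg_sub]
    refine neg_mem (commutator_mem_of_forall_ι _ _ (fun a => ?_) x)
    rw [mem_brIdeal]
    have := mem_brSpan (BrProd.one.mul (IsBr.two (v := (ι ℂ : X → FreeAlgebra ℂ X)) b a)) 1
    simpa using this
  have := commFiltration_le (brIdeal X) hanti
    (fun x => by
      rw [mem_brIdeal]
      have := mem_brSpan (BrProd.one (v := (ι ℂ : X → FreeAlgebra ℂ X)) (L := ∅)) x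
      simpa using this) hmul h2
    (fun i _ x hx y => by
      rw [mem_brIdeal] at hx
      induction hx using AddSubgroup.closure_induction with
      | mem x hx =>
        obtain ⟨j, hj, g, w, hw, rfl⟩ := hx
        have e : g * w * y - y * (g * w) = g * (w * y - y * w) + (g * y - y * g) * w := by
          noncomm_ring
        rw [e]
        refine add_mem ((brIdeal X _).mul_mem_left _ _ ?_) (hanti (by omega : i + 1 ≤ 2 + j)
          (hmul _ _ _ _ (h2 g y) ?_))
        · refine hanti (by omega : i + 1 ≤ j + 1) (commutator_mem_of_forall_ι _ _ (fun x => ?_) y)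
          rw [mem_brIdeal]
          exact brSpan_of_closure (hw.commutator x)
        · rw [mem_brIdeal]
          simpa using mem_brSpan hw 1
      | zero => rw [zero_mul, mul_zero, sub_self]; exact zero_mem _
      | add a b _ _ h1 h2 =>
        have e : (a + b) * y - y * (a + b) = (a * y - y * a) + (b * y - y * b) := by noncomm_ring
        rw [e]; exact add_mem h1 h2
      | neg a _ h1 =>
        have e : -a * y - y * -a = -(a * y - y * a) := by noncomm_ring
        rw [e]; exact neg_mem h1) hf
  rwa [mem_brIdeal] at this

end FreeBrackets

section Symbol

open FreeAlgebra Polynomial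

variable {R A : Type} [Ring R] [Algebra ℂ R] [CommRing A] [Algebra ℂ A]

/-- Evaluation `ℂ⟨R⟩ → R` of formal noncommutative polynomials in the elements of `R`. -/
def evalHom (R : Type) [Ring R] [Algebra ℂ R] : FreeAlgebra ℂ R →ₐ[ℂ] R := FreeAlgebra.lift ℂ id

@[simp] lemma evalHom_ι (r : R) : evalHom R (ι ℂ r) = r := by simp [evalHom]

lemma evalHom_surjective : Function.Surjective (evalHom R) := fun r => ⟨ι ℂ r, evalHom_ι r⟩

/-- Extension of scalars `ℂ⟨R⟩ → A⟨R⟩`. -/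
def scalarExt (R A : Type) [CommRing A] [Algebra ℂ A] : FreeAlgebra ℂ R →ₐ[ℂ] FreeAlgebra A R :=
  FreeAlgebra.lift ℂ (ι A)

omit [Ring R] [Algebra ℂ R] in
@[simp] lemma scalarExt_ι (r : R) : scalarExt R A (ι ℂ r) = ι A r := by simp [scalarExt]

/-- The universal Taylor expansion `ℂ⟨R⟩ → A⟨R⟩[h]`, sending the generator `r` to
`π r + h • r`. -/
def taylorHom (π : R →ₐ[ℂ] A) : FreeAlgebra ℂ R →ₐ[ℂ] (FreeAlgebra A R)[X] :=
  FreeAlgebra.lift ℂ fun r => C (algebraMap A _ (π r)) + C (ι A r) * X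

variable (π : R →ₐ[ℂ] A)

lemma taylorHom_ι (r : R) :
    taylorHom π (ι ℂ r) = C (algebraMap A _ (π r)) + C (ι A r) * X := by simp [taylorHom]

lemma taylorHom_coeff_zero (f : FreeAlgebra ℂ R) :
    (taylorHom π f).coeff 0 = algebraMap A _ (π (evalHom R f)) := by
  induction f using FreeAlgebra.induction with
  | grade0 c =>
    rw [AlgHom.commutes, AlgHom.commutes, AlgHom.commutes, Polynomial.algebraMap_apply, coeff_C_zero]
    exact IsScalarTower.algebraMap_apply ℂ A (FreeAlgebra A R) c
  | grade1 x => simp [taylorHom_ι]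
  | mul f g hf hg => rw [map_mul, mul_coeff_zero, hf, hg]; simp
  | add f g hf hg => rw [map_add, coeff_add, hf, hg]; simp

lemma taylorHom_coeff_zero_comm (f : FreeAlgebra ℂ R) (t : FreeAlgebra A R) :
    (taylorHom π f).coeff 0 * t = t * (taylorHom π f).coeff 0 := by
  rw [taylorHom_coeff_zero]; exact Algebra.commutes _ _

lemma taylorHom_isBr {n : ℕ} {w : FreeAlgebra ℂ R} (h : IsBr (ι ℂ) n w) :
    taylorHom π w = C (scalarExt R A w) * X ^ n := by
  have hX : ∀ p : (FreeAlgebra A R)[X], p * X = X * p := fun p => (X_mul).symm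
  have hC : ∀ (a : A) (p : (FreeAlgebra A R)[X]), p * C (algebraMap A _ a) = C (algebraMap A _ a) * p := by
    intro a p
    ext n
    rw [coeff_C_mul, coeff_mul_C, Algebra.commutes]
  have hcomm : ∀ (a : A) (p q : (FreeAlgebra A R)[X]),
      p * (C (algebraMap A _ a) + q) - (C (algebraMap A _ a) + q) * p = p * q - q * p := by
    intro a p q
    rw [mul_add, add_mul, hC]; abel
  have hmul : ∀ (s t : FreeAlgebra A R) (n : ℕ),
      C s * X ^ n * (C t * X) = C (s * t) * X ^ (n + 1) := by
    intro s t n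
    rw [mul_assoc, ← mul_assoc (X ^ n), X_pow_mul, C_mul, pow_succ, mul_assoc, mul_assoc]
  have hmul' : ∀ (s t : FreeAlgebra A R) (n : ℕ),
      C s * X * (C t * X ^ n) = C (s * t) * X ^ (n + 1) := by
    intro s t n
    rw [mul_assoc, ← mul_assoc X, ← hX, C_mul, pow_succ', mul_assoc, mul_assoc]
  induction h with
  | two x y =>
    rw [map_sub, map_mul, map_mul, taylorHom_ι, taylorHom_ι, hcomm, ← neg_sub, hcomm]
    have h1 := hmul (ι A x) (ι A y) 1
    have h2 := hmul (ι A y) (ι A x) 1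
    rw [pow_one] at h1 h2
    rw [h1, h2]
    simp only [map_sub, map_mul, scalarExt_ι, sub_mul, neg_sub]
  | @succ n b h x ih =>
    rw [map_sub, map_mul, map_mul, taylorHom_ι, hcomm, ih, hmul, hmul']
    simp only [map_sub, map_mul, scalarExt_ι, sub_mul]

lemma taylorHom_brProd {n : ℕ} {w : FreeAlgebra ℂ R} (h : BrProd (ι ℂ) ∅ n w) :
    taylorHom π w = C (scalarExt R A w) * X ^ n := by
  induction h with
  | one => simp
  | letter h hx ih => exact absurd hx (Set.notMem_empty _)
  | @mul n m t b h hb ih =>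
    rw [map_mul, map_mul, ih, taylorHom_isBr π hb, mul_assoc, ← mul_assoc (X ^ n), X_pow_mul,
      mul_assoc, ← pow_add, C_mul, mul_assoc]

lemma taylorHom_mul_brProd_coeff {n : ℕ} {w : FreeAlgebra ℂ R} (h : BrProd (ι ℂ) ∅ n w)
    (g : FreeAlgebra ℂ R) : (taylorHom π (g * w)).coeff n
      = algebraMap A _ (π (evalHom R g)) * scalarExt R A w := by
  rw [map_mul, taylorHom_brProd π h, ← mul_assoc, coeff_mul_X_pow', if_pos le_rfl, Nat.sub_self,
    coeff_mul_C, taylorHom_coeff_zero]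

omit [Ring R] [Algebra ℂ R] in
lemma basisFreeMonoid_eq (K : Type) [CommRing K] (s : FreeMonoid R) :
    basisFreeMonoid K R s = FreeMonoid.lift (ι K) s := by
  simp [basisFreeMonoid, equivMonoidAlgebraFreeMonoid]

/-- The degree `m` coefficient of the Taylor expansion controls the class in `I_m / I_{m+1}`. -/
lemma exists_symbol_section {π : R →ₐ[ℂ] A} (hπ : IsAbelianization π) (m : ℕ) :
    ∃ Λ : FreeAlgebra A R →+ R ⧸ (commFiltration R (m + 1)).asIdeal,
      ∀ g w, BrProd (ι ℂ) ∅ m w → Λ (algebraMap A _ (π (evalHom R g)) * scalarExt R A w)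
        = Ideal.Quotient.mk _ (evalHom R (g * w)) := by
  set W : Submodule ℂ (FreeAlgebra ℂ R) := Submodule.span ℂ {w | BrProd (ι ℂ) ∅ m w} with hW
  obtain ⟨θ, hθ⟩ := LinearMap.exists_leftInverse_of_injective W.subtype (Submodule.ker_subtype W)
  have hθ' : ∀ w (hw : w ∈ W), (θ w : FreeAlgebra ℂ R) = w := fun w hw => by
    have := LinearMap.congr_fun hθ ⟨w, hw⟩
    simpa using congrArg Subtype.val this
  have hWI : ∀ w ∈ W, evalHom R w ∈ commFiltration R m := fun w hw => by
    refine Submodule.span_induction (p := fun w _ => evalHom R w ∈ commFiltration R m)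
      (fun w hw => commFiltration_map _ (BrProd.mem_commFiltration hw)) (by simp [zero_mem])
      (fun _ _ _ _ h h' => by rw [map_add]; exact add_mem h h')
      (fun c _ _ h => by rw [map_smul]; exact twoSidedIdeal_smul_mem _ c h) hw
  choose sec hsec using hπ.1
  have key : ∀ (z : R), z ∈ commFiltration R m → ∀ r r' : R, π r = π r' →
      Ideal.Quotient.mk (commFiltration R (m + 1)).asIdeal (r * z)
        = Ideal.Quotient.mk (commFiltration R (m + 1)).asIdeal (r' * z) := by
    intro z hz r r' h
    rw [Ideal.Quotient.eq, ← sub_mul, TwoSidedIdeal.mem_asIdeal]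
    exact commFiltration_antitone (by omega) (commFiltration_mul_mem
      ((hπ.2 _).1 (by rw [map_sub, h, sub_self])) hz)
  let z : FreeMonoid R → R := fun s => evalHom R (θ (basisFreeMonoid ℂ R s))
  have hz : ∀ s, z s ∈ commFiltration R m := fun s => hWI _ (θ _).2
  let Θ : FreeMonoid R → A →+ R ⧸ (commFiltration R (m + 1)).asIdeal := fun s =>
    AddMonoidHom.mk' (fun a => Ideal.Quotient.mk _ (sec a * z s)) (fun a b => by
      rw [← map_add, ← add_mul]
      exact key _ (hz s) _ _ (by rw [map_add, hsec, hsec, hsec]))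
  refine ⟨(Finsupp.liftAddHom Θ).comp (basisFreeMonoid A R).repr.toAddEquiv.toAddMonoidHom, ?_⟩
  intro g w hw
  have hw' : w ∈ W := Submodule.subset_span hw
  have hb : ∀ s, scalarExt R A (basisFreeMonoid ℂ R s) = basisFreeMonoid A R s := by
    intro s
    rw [basisFreeMonoid_eq, basisFreeMonoid_eq]
    induction s using FreeMonoid.inductionOn' with
    | one => simp
    | of_mul x s ih => rw [map_mul, map_mul, map_mul, ih]; simp
  have hrepr := (basisFreeMonoid ℂ R).linearCombination_repr w
  set c := (basisFreeMonoid ℂ R).repr w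
  have h1 : ∀ (s : FreeMonoid R), algebraMap A _ (π (evalHom R g)) * scalarExt R A
      (c s • basisFreeMonoid ℂ R s) = π (c s • evalHom R g) • basisFreeMonoid A R s := by
    intro s
    rw [map_smul, hb, map_smul, mul_smul_comm, ← Algebra.smul_def, smul_assoc]
  have h2 : ∀ (s : FreeMonoid R), ((Finsupp.liftAddHom Θ).comp
      (basisFreeMonoid A R).repr.toAddEquiv.toAddMonoidHom)
        (π (c s • evalHom R g) • basisFreeMonoid A R s)
        = Ideal.Quotient.mk _ (evalHom R g * evalHom R (θ (c s • basisFreeMonoid ℂ R s))) := by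
    intro s
    have e : ((Finsupp.liftAddHom Θ).comp
      (basisFreeMonoid A R).repr.toAddEquiv.toAddMonoidHom)
        (π (c s • evalHom R g) • basisFreeMonoid A R s) = Θ s (π (c s • evalHom R g)) := by
      generalize π (c s • evalHom R g) = a
      simp
    rw [e]
    change Ideal.Quotient.mk _ (sec (π (c s • evalHom R g)) * z s) = _
    rw [key (z s) (hz s) _ (c s • evalHom R g) (hsec _), map_smul, Submodule.coe_smul, map_smul,
      smul_mul_assoc, mul_smul_comm]
  rw [Finsupp.linearCombination_apply, Finsupp.sum] at hrepr
  conv_lhs => rw [← hrepr]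
  rw [map_sum, Finset.mul_sum, map_sum]
  simp_rw [h1, h2]
  rw [← map_sum, ← Finset.mul_sum, ← map_sum, ← Submodule.coe_sum, ← map_sum, hrepr, hθ' w hw',
    map_mul, map_mul, map_mul]

lemma evalHom_mem_of_coeff_eq_zero {π : R →ₐ[ℂ] A} (hπ : IsAbelianization π) {m : ℕ}
    {f : FreeAlgebra ℂ R} (hf : f ∈ commFiltration (FreeAlgebra ℂ R) m)
    (h : (taylorHom π f).coeff m = 0) : evalHom R f ∈ commFiltration R (m + 1) := by
  obtain ⟨Λ, hΛ⟩ := exists_symbol_section hπ m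
  suffices Λ ((taylorHom π f).coeff m) = Ideal.Quotient.mk _ (evalHom R f) by
    rw [h, map_zero, eq_comm, Ideal.Quotient.eq_zero_iff_mem, TwoSidedIdeal.mem_asIdeal] at this
    exact this
  replace hf := mem_brSpan_of_mem_commFiltration hf
  clear h
  induction hf using AddSubgroup.closure_induction with
  | mem f hf =>
    obtain ⟨j, hj, g, w, hw, rfl⟩ := hf
    rcases hj.lt_or_eq with hj | rfl
    · have h1 : g * w ∈ commFiltration _ j := TwoSidedIdeal.mul_mem_left _ _ _ hw.mem_commFiltration
      rw [low_of_mem_commFiltration _ (taylorHom_coeff_zero_comm π) h1 m hj, map_zero, eq_comm,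
        Ideal.Quotient.eq_zero_iff_mem, TwoSidedIdeal.mem_asIdeal]
      exact commFiltration_antitone hj (commFiltration_map _ h1)
    · rw [taylorHom_mul_brProd_coeff π hw, hΛ g w hw]
  | zero => simp
  | add y z _ _ h1 h2 => simp only [map_add, coeff_add, h1, h2]
  | neg y _ h1 => simp only [map_neg, coeff_neg, h1]

end Symbol

section TaylorSection

open FreeAlgebra Polynomial

variable {R A : Type} [Ring R] [Algebra ℂ R] [CommRing A] [Algebra ℂ A] (π : R →ₐ[ℂ] A)

/-- Elements of `ℂ⟨R⟩` evaluating into `I_N R` whose Taylor expansion is divisible by `h ^ j`. -/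
def taylorIdeal (N j : ℕ) : TwoSidedIdeal (FreeAlgebra ℂ R) :=
  (commFiltration R N).comap (evalHom R) ⊓ (lowIdeal _ j).comap (taylorHom π)

lemma mem_taylorIdeal {N j : ℕ} {f : FreeAlgebra ℂ R} : f ∈ taylorIdeal π N j ↔
    evalHom R f ∈ commFiltration R N ∧ Low j (taylorHom π f) := by
  rw [← mem_lowIdeal, taylorIdeal, TwoSidedIdeal.mem_inf, TwoSidedIdeal.mem_comap,
    TwoSidedIdeal.mem_comap]

/-- The quotient of `ℂ⟨R⟩` by `taylorIdeal`. -/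
abbrev TaylorQuot (N j : ℕ) : Type := FreeAlgebra ℂ R ⧸ (taylorIdeal π N j).asIdeal

/-- The quotient map onto `TaylorQuot`. -/
abbrev taylorMk (N j : ℕ) : FreeAlgebra ℂ R →ₐ[ℂ] TaylorQuot π N j :=
  Ideal.Quotient.mkₐ ℂ (taylorIdeal π N j).asIdeal

lemma taylorMk_surjective (N j : ℕ) : Function.Surjective (taylorMk π N j) :=
  Ideal.Quotient.mkₐ_surjective ℂ _

lemma taylorMk_eq_iff {N j : ℕ} {f g : FreeAlgebra ℂ R} : taylorMk π N j f = taylorMk π N j g ↔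
    evalHom R f - evalHom R g ∈ commFiltration R N ∧ Low j (taylorHom π f - taylorHom π g) := by
  rw [← map_sub, ← map_sub, ← mem_taylorIdeal]
  exact Ideal.Quotient.eq

lemma isNCNilpotent_taylorQuot (N j : ℕ) : IsNCNilpotent (TaylorQuot π N j) := by
  refine ⟨max N j, fun x hx => ?_⟩
  obtain ⟨f, hf, rfl⟩ := exists_commFiltration_of_surjective (taylorMk_surjective π N j) hx
  rw [← map_zero (taylorMk π N j), taylorMk_eq_iff, map_zero, map_zero, sub_zero, sub_zero]
  exact ⟨commFiltration_antitone (by omega) (commFiltration_map _ hf),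
    (low_of_mem_commFiltration _ (taylorHom_coeff_zero_comm π) hf).mono (by omega)⟩

lemma exists_taylor_lift (hR : IsNCSmooth R) (N j : ℕ) : ∃ s : R →ₐ[ℂ] TaylorQuot π N (j + 1),
      ∀ f r, taylorMk π N (j + 1) f = s r → evalHom R f - r ∈ commFiltration R N := by
  induction j with
  | zero =>
    have key : ∀ f g : FreeAlgebra ℂ R, evalHom R f = evalHom R g →
        taylorMk π N 1 f = taylorMk π N 1 g := by
      intro f g h
      rw [taylorMk_eq_iff]
      refine ⟨by rw [h, sub_self]; exact zero_mem _, fun i hi => ?_⟩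
      obtain rfl : i = 0 := by omega
      rw [coeff_sub, taylorHom_coeff_zero, taylorHom_coeff_zero, h, sub_self]
    refine ⟨AlgHom.mk' { toFun := fun r => taylorMk π N 1 (ι ℂ r), map_one' := ?_, map_mul' := ?_,
                         map_zero' := ?_, map_add' := ?_ } ?_, ?_⟩
    · rw [← map_one (taylorMk π N 1)]; exact key _ _ (by simp)
    · intro x y; rw [← map_mul (taylorMk π N 1)]; exact key _ _ (by simp)
    · rw [← map_zero (taylorMk π N 1)]; exact key _ _ (by simp)
    · intro x y; rw [← map_add (taylorMk π N 1)]; exact key _ _ (by simp)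
    · intro c x
      change taylorMk π N 1 (ι ℂ (c • x)) = c • taylorMk π N 1 (ι ℂ x)
      rw [← map_smul (taylorMk π N 1)]; exact key _ _ (by simp)
    · intro f r h
      have h' : taylorMk π N 1 f = taylorMk π N 1 (ι ℂ r) := h
      rw [taylorMk_eq_iff, evalHom_ι] at h'
      exact h'.1
  | succ j ih =>
    obtain ⟨s, hs⟩ := ih
    have hle : (taylorIdeal π N (j + 1 + 1)).asIdeal ≤ (taylorIdeal π N (j + 1)).asIdeal := by
      intro f hf
      rw [TwoSidedIdeal.mem_asIdeal, mem_taylorIdeal] at hf ⊢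
      exact ⟨hf.1, hf.2.mono (by omega)⟩
    let q : TaylorQuot π N (j + 1 + 1) →ₐ[ℂ] TaylorQuot π N (j + 1) :=
      Ideal.Quotient.factorₐ ℂ hle
    have hq : ∀ f, q (taylorMk π N (j + 1 + 1) f) = taylorMk π N (j + 1) f := fun f => rfl
    have hker : ∀ f, q (taylorMk π N (j + 1 + 1) f) = 0 →
        evalHom R f ∈ commFiltration R N ∧ Low (j + 1) (taylorHom π f) := by
      intro f hf
      rw [hq, ← map_zero (taylorMk π N (j + 1)), taylorMk_eq_iff] at hf
      simpa using hf
    have hcent : IsCentralExtension q := by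
      refine ⟨fun y => ?_, fun x hx y => ?_, fun x y hx hy => ?_⟩
      · obtain ⟨f, rfl⟩ := taylorMk_surjective π _ _ y
        exact ⟨_, hq f⟩
      · obtain ⟨f, rfl⟩ := taylorMk_surjective π _ _ x
        obtain ⟨g, rfl⟩ := taylorMk_surjective π _ _ y
        obtain ⟨h1, h2⟩ := hker f hx
        rw [← map_mul, ← map_mul, taylorMk_eq_iff, map_mul, map_mul, map_mul, map_mul]
        exact ⟨sub_mem (TwoSidedIdeal.mul_mem_right _ _ _ h1) (TwoSidedIdeal.mul_mem_left _ _ _ h1),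
          h2.commutator (taylorHom_coeff_zero_comm π g)⟩
      · obtain ⟨f, rfl⟩ := taylorMk_surjective π _ _ x
        obtain ⟨g, rfl⟩ := taylorMk_surjective π _ _ y
        obtain ⟨h1, h2⟩ := hker f hx
        obtain ⟨h3, h4⟩ := hker g hy
        rw [← map_mul, ← map_zero (taylorMk π N (j + 1 + 1)), taylorMk_eq_iff, map_mul, map_mul,
          map_zero, map_zero, sub_zero, sub_zero]
        exact ⟨TwoSidedIdeal.mul_mem_right _ _ _ h1, (h2.mul h4).mono (by omega)⟩
    obtain ⟨g, hg⟩ := hR.2 _ _ inferInstance inferInstance inferInstance inferInstance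
      (isNCNilpotent_taylorQuot π N _) (isNCNilpotent_taylorQuot π N _) q hcent s
    refine ⟨g, fun f r h => hs f r ?_⟩
    rw [← hq, h, ← hg]; rfl

end TaylorSection

section TaylorDataSection

open FreeAlgebra Polynomial

variable {R A : Type} [Ring R] [Algebra ℂ R] [CommRing A] [Algebra ℂ A]

/-- The `A`-span of degree `m` products of iterated commutators of generators of `A⟨X⟩`. -/
def brModule (A X : Type) [CommRing A] (m : ℕ) : Submodule A (FreeAlgebra A X) :=
  Submodule.span A {w | BrProd (ι A) ∅ m w}

/-- The elements of `A⟨X⟩` of degree one. -/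
def degOne (A X : Type) [CommRing A] : Submodule A (FreeAlgebra A X) :=
  Submodule.span A (Set.range (ι A))

/-- A truncated noncommutative Taylor expansion `r ↦ ∑ φ i r` (`i < N`) of the elements of `R`
with coefficients in a copy of `A⟨R⟩` projected by the substitution `ι x ↦ δ x`. -/
structure TaylorData (π : R →ₐ[ℂ] A) (N : ℕ) where
  δ : R → FreeAlgebra A R
  φ : ℕ → R → FreeAlgebra A R
  δ_mem : ∀ b, δ b ∈ degOne A R
  subst_δ : ∀ b, FreeAlgebra.lift A δ (δ b) = δ b
  φ_zero : ∀ r, φ 0 r = algebraMap A _ (π r)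
  φ_one : ∀ r, φ 1 r = δ r
  φ_add : ∀ i < N, ∀ r r', φ i (r + r') = φ i r + φ i r'
  φ_mul : ∀ i < N, ∀ r r', φ i (r * r') = ∑ x ∈ Finset.HasAntidiagonal.antidiagonal i, φ x.1 r * φ x.2 r'
  φ_eq_zero : ∀ m r, r ∈ commFiltration R m → ∀ i < m, i < N → φ i r = 0
  mem_succ : ∀ m r, 2 ≤ m → m < N → r ∈ commFiltration R m → φ m r = 0 →
    r ∈ commFiltration R (m + 1)
  exists_of_mem : ∀ m w, 2 ≤ m → m < N → w ∈ brModule A R m →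
    ∃ r ∈ commFiltration R m, φ m r = FreeAlgebra.lift A δ w
  φ_mem : ∀ m r, 2 ≤ m → m < N → r ∈ commFiltration R m →
    ∃ w ∈ brModule A R m, φ m r = FreeAlgebra.lift A δ w
  φ_range : ∀ i r, φ i r ∈ (FreeAlgebra.lift A δ).range
  φ_pow : ∀ i r, φ i r ∈ degOne A R ^ i

lemma taylorHom_coeff_mem (π : R →ₐ[ℂ] A) (f : FreeAlgebra ℂ R) (i : ℕ) :
    (taylorHom π f).coeff i ∈ degOne A R ^ i := by
  induction f using FreeAlgebra.induction generalizing i with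
  | grade0 c =>
    rw [AlgHom.commutes, Polynomial.algebraMap_apply, coeff_C]
    split_ifs with h
    · subst h
      rw [pow_zero, IsScalarTower.algebraMap_apply ℂ A (FreeAlgebra A R)]
      exact Submodule.algebraMap_mem _
    · exact zero_mem _
  | grade1 x =>
    rw [taylorHom_ι, coeff_add, coeff_C, coeff_C_mul, coeff_X]
    rcases i with _ | _ | i
    · simp only [if_true, one_ne_zero, if_false, mul_zero, add_zero, pow_zero]
      exact Submodule.algebraMap_mem _
    · simp only [zero_add, one_ne_zero, if_false, if_true, mul_one, pow_one]
      exact Submodule.subset_span ⟨x, rfl⟩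
    · simp
  | mul f g hf hg =>
    rw [map_mul, coeff_mul]
    refine Submodule.sum_mem _ fun x hx => ?_
    rw [Finset.HasAntidiagonal.mem_antidiagonal] at hx
    rw [← hx, pow_add]
    exact Submodule.mul_mem_mul (hf _) (hg _)
  | add f g hf hg => rw [map_add, coeff_add]; exact add_mem (hf i) (hg i)

omit [Ring R] [Algebra ℂ R] [Algebra ℂ A] in
lemma lift_mem_degOne_pow {δ : R → FreeAlgebra A R} (hδ : ∀ b, δ b ∈ degOne A R) {i : ℕ}
    {t : FreeAlgebra A R} (ht : t ∈ degOne A R ^ i) : FreeAlgebra.lift A δ t ∈ degOne A R ^ i := by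
  have h1 : (degOne A R).map (FreeAlgebra.lift A δ).toLinearMap ≤ degOne A R := by
    rw [degOne, Submodule.map_span_le]
    rintro _ ⟨x, rfl⟩
    have := hδ x
    simpa [degOne] using this
  have h2 : (degOne A R ^ i).map (FreeAlgebra.lift A δ).toLinearMap ≤ degOne A R ^ i := by
    rw [Submodule.map_pow]
    exact pow_le_pow_left' h1 i
  exact h2 ⟨t, ht, rfl⟩

lemma taylorHom_coeff_mem_brModule (π : R →ₐ[ℂ] A) {m : ℕ} {f : FreeAlgebra ℂ R}
    (hf : f ∈ commFiltration (FreeAlgebra ℂ R) m) : (taylorHom π f).coeff m ∈ brModule A R m := by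
  replace hf := mem_brSpan_of_mem_commFiltration hf
  induction hf using AddSubgroup.closure_induction with
  | mem f hf =>
    obtain ⟨j, hj, g, w, hw, rfl⟩ := hf
    rcases hj.lt_or_eq with hj | rfl
    · rw [low_of_mem_commFiltration _ (taylorHom_coeff_zero_comm π)
        (TwoSidedIdeal.mul_mem_left _ g _ hw.mem_commFiltration) m hj]
      exact zero_mem _
    · rw [taylorHom_mul_brProd_coeff π hw, ← Algebra.smul_def]
      refine Submodule.smul_mem _ _ (Submodule.subset_span ?_)
      simpa using hw.map (scalarExt R A).toRingHom
  | zero => simp [zero_mem]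
  | add y z _ _ h1 h2 => rw [map_add, coeff_add]; exact add_mem h1 h2
  | neg y _ h1 => rw [map_neg, coeff_neg]; exact neg_mem h1

theorem nonempty_taylorData (hR : IsNCSmooth R) {π : R →ₐ[ℂ] A} (hπ : IsAbelianization π) {N : ℕ}
    (hN : 2 ≤ N) : Nonempty (TaylorData π N) := by
  obtain ⟨s, hs⟩ : ∃ s : R →ₐ[ℂ] TaylorQuot π N N,
      ∀ f r, taylorMk π N N f = s r → evalHom R f - r ∈ commFiltration R N := by
    obtain ⟨j, rfl⟩ : ∃ j, N = j + 1 := ⟨N - 1, by omega⟩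
    exact exists_taylor_lift π hR _ j
  choose lft hlft using fun r => taylorMk_surjective π N N (s r)
  have hwd : ∀ f r, taylorMk π N N f = s r → ∀ i < N,
      (taylorHom π (lft r)).coeff i = (taylorHom π f).coeff i := by
    intro f r h i hi
    rw [← hlft, eq_comm, taylorMk_eq_iff] at h
    exact sub_eq_zero.1 (by rw [← coeff_sub]; exact h.2 i hi)
  have hcoeff0 : ∀ f r, taylorMk π N N f = s r → (taylorHom π f).coeff 0 = algebraMap A _ (π r) := by
    intro f r h
    have := commFiltration_antitone hN (hs f r h)
    rw [← hπ.2, map_sub, sub_eq_zero] at this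
    rw [taylorHom_coeff_zero, this]
  have hadd : ∀ r r', taylorMk π N N (lft r + lft r') = s (r + r') := by
    intro r r'; rw [map_add, map_add, hlft, hlft]
  have hmul : ∀ r r', taylorMk π N N (lft r * lft r') = s (r * r') := by
    intro r r'; rw [map_mul, map_mul, hlft, hlft]
  let δ : R → FreeAlgebra A R := fun r => (taylorHom π (lft r)).coeff 1
  let Te : FreeAlgebra A R →ₐ[A] FreeAlgebra A R := FreeAlgebra.lift A δ
  have hTeι : ∀ x, Te (ι A x) = δ x := fun x => by simp [Te]
  have hδ : ∀ b, δ b ∈ degOne A R := fun b => by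
    have := taylorHom_coeff_mem π (lft b) 1
    rwa [pow_one] at this
  have hδadd : ∀ r r', δ (r + r') = δ r + δ r' := by
    intro r r'
    simp only [δ]
    rw [hwd _ _ (hadd r r') 1 hN, map_add, coeff_add]
  have hδmul : ∀ r r', δ (r * r') = algebraMap A _ (π r) * δ r' + δ r * algebraMap A _ (π r') := by
    intro r r'
    simp only [δ]
    rw [hwd _ _ (hmul r r') 1 hN, map_mul, mul_coeff_one, hcoeff0 _ _ (hlft r),
      hcoeff0 _ _ (hlft r')]
  have hδI : ∀ m r, r ∈ commFiltration R m → ∀ i < m, i < N → (taylorHom π (lft r)).coeff i = 0 := by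
    intro m r hr i hi hiN
    obtain ⟨f, hf, hfr⟩ := exists_commFiltration_of_surjective (taylorMk_surjective π N N)
      (commFiltration_map s hr)
    rw [hwd f r hfr i hiN]
    exact low_of_mem_commFiltration _ (taylorHom_coeff_zero_comm π) hf i hi
  let Ψ : FreeAlgebra ℂ R →ₐ[ℂ] (FreeAlgebra A R)[X] :=
    (Polynomial.mapAlgHom (Te.restrictScalars ℂ)).comp (taylorHom π)
  have hΨ : ∀ f i, (Ψ f).coeff i = Te ((taylorHom π f).coeff i) := fun f i => by
    simp only [Ψ, AlgHom.comp_apply, Polynomial.coe_mapAlgHom, coeff_map]; rfl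
  have hΨ0 : ∀ f, (Ψ f).coeff 0 = algebraMap A _ (π (evalHom R f)) := fun f => by
    rw [hΨ, taylorHom_coeff_zero, AlgHom.commutes]
  have hΨ1 : ∀ f, (Ψ f).coeff 1 = δ (evalHom R f) := by
    intro f
    induction f using FreeAlgebra.induction with
    | grade0 c =>
      simp only [δ]
      rw [hwd (algebraMap ℂ _ c) _ (by simp only [AlgHom.commutes]) 1 hN, hΨ, AlgHom.commutes,
        Polynomial.algebraMap_apply, coeff_C_of_ne_zero one_ne_zero, map_zero]
    | grade1 x => rw [hΨ, taylorHom_ι, evalHom_ι]; simp [coeff_C, hTeι]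
    | mul f g hf hg => rw [map_mul, mul_coeff_one, hf, hg, hΨ0, hΨ0, map_mul, hδmul]
    | add f g hf hg => rw [map_add, coeff_add, hf, hg, map_add, hδadd]
  have hTeδ : ∀ b, Te (δ b) = δ b := by
    intro b
    have h1 := hΨ1 (lft b)
    rw [hΨ] at h1
    refine h1.trans ?_
    have h2 := hδI 2 _ (commFiltration_antitone hN (hs _ _ (hlft b))) 1 (by norm_num) hN
    have h3 := hδadd (evalHom R (lft b) - b) b
    rw [sub_add_cancel] at h3
    rw [h3]
    simp only [δ]
    rw [h2, zero_add]
  have hTeTe : ∀ t, Te (Te t) = Te t := by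
    intro t
    have : Te.comp Te = Te := by
      ext x
      simp [hTeι, hTeδ]
    exact AlgHom.congr_fun this t
  -- pairs of formal expressions for the same element, in the two possible senses
  let P := AlgHom.equalizer ((taylorMk π N N).comp (AlgHom.fst ℂ (FreeAlgebra ℂ R) (FreeAlgebra ℂ R)))
    ((s.comp (evalHom R)).comp (AlgHom.snd ℂ (FreeAlgebra ℂ R) (FreeAlgebra ℂ R)))
  let P1 : P →ₐ[ℂ] FreeAlgebra ℂ R := (AlgHom.fst ℂ _ _).comp P.val
  let P2 : P →ₐ[ℂ] FreeAlgebra ℂ R := (AlgHom.snd ℂ _ _).comp P.val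
  have hP : ∀ x, taylorMk π N N (P1 x) = s (evalHom R (P2 x)) := fun x => x.2
  have hP2 : Function.Surjective P2 := fun g => by
    obtain ⟨f, hf⟩ := taylorMk_surjective π N N (s (evalHom R g))
    exact ⟨⟨(f, g), hf⟩, rfl⟩
  have hL : ∀ m, 2 ≤ m → m < N → ∀ g ∈ commFiltration (FreeAlgebra ℂ R) m,
      ∃ f ∈ commFiltration (FreeAlgebra ℂ R) m, taylorMk π N N f = s (evalHom R g) ∧
        (taylorHom π f).coeff m = Te ((taylorHom π g).coeff m) := by
    intro m hm hmN g hg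
    obtain ⟨x, hx, rfl⟩ := exists_commFiltration_of_surjective hP2 hg
    refine ⟨P1 x, commFiltration_map P1 hx, hP x, ?_⟩
    have := low_sub_of_mem_commFiltration ((taylorHom π).comp P1) (Ψ.comp P2)
      (fun x => taylorHom_coeff_zero_comm π _)
      (fun x t => by
        rw [AlgHom.comp_apply, hΨ0]; exact Algebra.commutes _ _)
      (fun x i hi => by
        rw [coeff_sub, sub_eq_zero]
        change (taylorHom π (P1 x)).coeff i = (Ψ (P2 x)).coeff i
        rcases (by omega : i = 0 ∨ i = 1) with rfl | rfl
        · rw [hΨ0, hcoeff0 _ _ (hP x)]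
        · rw [hΨ1, ← hwd _ _ (hP x) 1 hN]) hm hx m (Nat.lt_succ_self m)
    rw [coeff_sub, sub_eq_zero] at this
    rw [← hΨ]
    exact this
  have hexists : ∀ m r, 2 ≤ m → m < N → r ∈ commFiltration R m →
      ∃ f ∈ commFiltration (FreeAlgebra ℂ R) m, taylorMk π N N f = s r ∧
        Te ((taylorHom π f).coeff m) = (taylorHom π f).coeff m := by
    intro m r hm hmN hr
    obtain ⟨g, hg, rfl⟩ := exists_commFiltration_of_surjective evalHom_surjective hr
    obtain ⟨f, hf, h1, h2⟩ := hL m hm hmN g hg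
    exact ⟨f, hf, h1, by rw [h2, hTeTe]⟩
  refine ⟨⟨δ, fun i r => Te ((taylorHom π (lft r)).coeff i), hδ, hTeδ, ?_, hTeδ, ?_, ?_, ?_, ?_,
    ?_, ?_, fun i r => ⟨_, rfl⟩, fun i r => lift_mem_degOne_pow hδ (taylorHom_coeff_mem π _ i)⟩⟩
  · intro r
    rw [hcoeff0 _ _ (hlft r), AlgHom.commutes]
  · intro i hi r r'
    rw [hwd _ _ (hadd r r') i hi, map_add, coeff_add, map_add]
  · intro i hi r r'
    rw [hwd _ _ (hmul r r') i hi, map_mul, coeff_mul, map_sum]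
    simp only [map_mul]
  · intro m r hr i hi hiN
    rw [hδI m r hr i hi hiN, map_zero]
  · intro m r hm hmN hr h0
    obtain ⟨f, hf, h1, h2⟩ := hexists m r hm hmN hr
    rw [hwd f r h1 m hmN, h2] at h0
    have h3 := evalHom_mem_of_coeff_eq_zero hπ hf h0
    have h4 := commFiltration_antitone (by omega : m + 1 ≤ N) (hs f r h1)
    simpa using sub_mem h3 h4
  · intro m w hm hmN hw
    refine Submodule.span_induction (p := fun w _ => ∃ r ∈ commFiltration R m,
      Te ((taylorHom π (lft r)).coeff m) = Te w) ?_ ?_ ?_ ?_ hw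
    · intro w hw
      obtain ⟨g, hg, rfl⟩ := BrProd.exists_of_map (scalarExt R A).toRingHom (v := ι ℂ) (c := w)
        (by simpa using hw)
      obtain ⟨f, hf, h1, h2⟩ := hL m hm hmN g hg.mem_commFiltration
      refine ⟨evalHom R g, commFiltration_map _ hg.mem_commFiltration, ?_⟩
      rw [hwd _ _ h1 m hmN, h2, hTeTe]
      have := taylorHom_mul_brProd_coeff π hg 1
      rw [one_mul] at this
      rw [this]; simp
    · refine ⟨0, zero_mem _, ?_⟩
      rw [hwd 0 0 (by rw [map_zero, map_zero]) m hmN]; simp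
    · rintro w w' _ _ ⟨r, hr, h⟩ ⟨r', hr', h'⟩
      refine ⟨r + r', add_mem hr hr', ?_⟩
      rw [hwd _ _ (hadd r r') m hmN, map_add, coeff_add, map_add, h, h', map_add]
    · rintro a w _ ⟨r, hr, h⟩
      obtain ⟨b, rfl⟩ := hπ.1 a
      refine ⟨b * r, TwoSidedIdeal.mul_mem_left _ _ _ hr, ?_⟩
      have hlow : Low m (taylorHom π (lft r)) := fun i hi => hδI m r hr i hi (hi.trans hmN)
      have := (low_zero_left (taylorHom π (lft b))).coeff_mul hlow
      rw [zero_add] at this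
      rw [hwd _ _ (hmul b r) m hmN, map_mul, this, hcoeff0 _ _ (hlft b), ← Algebra.smul_def,
        map_smul, h, map_smul]
  · intro m r hm hmN hr
    obtain ⟨f, hf, h1, h2⟩ := hexists m r hm hmN hr
    refine ⟨_, taylorHom_coeff_mem_brModule π hf, ?_⟩
    rw [hwd f r h1 m hmN]

end TaylorDataSection

section Coordinates

open FreeAlgebra

variable {X A : Type} [CommRing A]

/-- The coefficient of the word `s` in an element of the free algebra. -/
def wordCoeff (s : FreeMonoid X) : FreeAlgebra A X →ₗ[A] A := (basisFreeMonoid A X).coord s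

/-- The word `s` as a monomial of the free algebra. -/
def word (A : Type) {X : Type} [CommRing A] (s : FreeMonoid X) : FreeAlgebra A X :=
  FreeMonoid.lift (ι A) s

lemma word_mul (s t : FreeMonoid X) : word A (s * t) = word A s * word A t := by simp [word]

lemma word_one : word A (1 : FreeMonoid X) = 1 := by simp [word]

lemma word_of (x : X) : word A (FreeMonoid.of x) = ι A x := by simp [word]

open Classical in
lemma wordCoeff_word (s t : FreeMonoid X) :
    wordCoeff s (word A t) = if t = s then 1 else 0 := by
  rw [wordCoeff, word, ← basisFreeMonoid_eq, Module.Basis.coord_apply, Module.Basis.repr_self,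
    Finsupp.single_apply]

lemma ext_wordCoeff {u v : FreeAlgebra A X} (h : ∀ s, wordCoeff s u = wordCoeff s v) : u = v :=
  (basisFreeMonoid A X).ext_elem h

lemma sum_wordCoeff_smul_word (u : FreeAlgebra A X) :
    ∃ S : Finset (FreeMonoid X), (∀ s, s ∈ S ↔ wordCoeff s u ≠ 0) ∧
      ∑ s ∈ S, wordCoeff s u • word A s = u := by
  refine ⟨((basisFreeMonoid A X).repr u).support, fun s => Finsupp.mem_support_iff, ?_⟩
  have := (basisFreeMonoid A X).linearCombination_repr u
  rw [Finsupp.linearCombination_apply, Finsupp.sum] at this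
  simpa only [wordCoeff, word, ← basisFreeMonoid_eq, Module.Basis.coord_apply] using this

lemma word_induction {P : FreeAlgebra A X → Prop} (u : FreeAlgebra A X)
    (word : ∀ s, P (word A s)) (zero : P 0) (add : ∀ u v, P u → P v → P (u + v))
    (smul : ∀ (a : A) u, P u → P (a • u)) : P u := by
  obtain ⟨S, -, hS⟩ := sum_wordCoeff_smul_word u
  rw [← hS]
  exact Finset.sum_induction _ P add zero fun s _ => smul _ _ (word s)

open Classical in
lemma wordCoeff_mul_degOne (s : FreeMonoid X) (y : X) (w : FreeAlgebra A X) {u : FreeAlgebra A X}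
    (hu : u ∈ degOne A X) : wordCoeff (s * FreeMonoid.of y) (w * u)
      = wordCoeff s w * wordCoeff (FreeMonoid.of y) u := by
  induction hu using Submodule.span_induction with
  | mem u hu =>
    obtain ⟨x, rfl⟩ := hu
    induction w using word_induction with
    | word t =>
      rw [← word_of, ← word_mul, wordCoeff_word, wordCoeff_word, wordCoeff_word]
      have : t * FreeMonoid.of x = s * FreeMonoid.of y ↔
          t = s ∧ FreeMonoid.of x = FreeMonoid.of y := by
        constructor
        · intro h
          have := congrArg FreeMonoid.toList h
          simp only [FreeMonoid.toList_mul, FreeMonoid.toList_of] at this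
          obtain ⟨h1, h2⟩ := List.append_inj' this rfl
          exact ⟨h1, h2⟩
        · rintro ⟨rfl, h⟩; rw [h]
      rw [if_congr this rfl rfl, ite_and]
      split_ifs <;> simp
    | zero => simp
    | add w w' h h' => rw [add_mul, map_add, h, h', map_add, add_mul]
    | smul a w h => rw [smul_mul_assoc, map_smul, h, map_smul, smul_mul_assoc]
  | zero => simp
  | add u u' _ _ h h' => rw [mul_add, map_add, h, h', map_add, mul_add]
  | smul a u _ h => rw [mul_smul_comm, map_smul, h, map_smul, mul_smul_comm]

open Classical in
lemma wordCoeff_degOne_mul (s : FreeMonoid X) (y : X) (w : FreeAlgebra A X) {u : FreeAlgebra A X}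
    (hu : u ∈ degOne A X) : wordCoeff (FreeMonoid.of y * s) (u * w)
      = wordCoeff (FreeMonoid.of y) u * wordCoeff s w := by
  induction hu using Submodule.span_induction with
  | mem u hu =>
    obtain ⟨x, rfl⟩ := hu
    induction w using word_induction with
    | word t =>
      rw [← word_of, ← word_mul, wordCoeff_word, wordCoeff_word, wordCoeff_word]
      have : FreeMonoid.of x * t = FreeMonoid.of y * s ↔
          FreeMonoid.of x = FreeMonoid.of y ∧ t = s := by
        constructor
        · intro h
          have := congrArg FreeMonoid.toList h
          simp only [FreeMonoid.toList_mul, FreeMonoid.toList_of] at this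
          obtain ⟨h1, h2⟩ := List.append_inj this rfl
          exact ⟨h1, h2⟩
        · rintro ⟨h, rfl⟩; rw [h]
      rw [if_congr this rfl rfl, ite_and]
      split_ifs <;> simp
    | zero => simp
    | add w w' h h' => rw [mul_add, map_add, h, h', map_add, mul_add]
    | smul a w h => rw [mul_smul_comm, map_smul, h, map_smul, mul_smul_comm]
  | zero => simp
  | add u u' _ _ h h' => rw [add_mul, map_add, h, h', map_add, add_mul]
  | smul a u _ h => rw [smul_mul_assoc, map_smul, h, map_smul, smul_mul_assoc]

lemma degOne_pow_le_span (m : ℕ) :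
    degOne A X ^ m ≤ Submodule.span A {u | ∃ s : FreeMonoid X, s.length = m ∧ u = word A s} := by
  induction m with
  | zero =>
    rw [pow_zero, Submodule.one_eq_span, Submodule.span_le]
    rintro _ rfl
    exact Submodule.subset_span ⟨1, rfl, word_one.symm⟩
  | succ m ih =>
    rw [pow_succ]
    refine (mul_le_mul_left ih _).trans ?_
    rw [degOne, Submodule.span_mul_span, Submodule.span_le]
    rintro _ ⟨_, ⟨s, hs, rfl⟩, _, ⟨x, rfl⟩, rfl⟩
    refine Submodule.subset_span ⟨s * FreeMonoid.of x, ?_, ?_⟩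
    · rw [FreeMonoid.length_mul, hs, FreeMonoid.length_of]
    · rw [word_mul, word_of]

lemma length_eq_of_wordCoeff_ne_zero {m : ℕ} {u : FreeAlgebra A X} (hu : u ∈ degOne A X ^ m)
    {s : FreeMonoid X} (hs : wordCoeff s u ≠ 0) : s.length = m := by
  contrapose! hs
  replace hu := degOne_pow_le_span m hu
  induction hu using Submodule.span_induction with
  | mem u hu =>
    obtain ⟨t, ht, rfl⟩ := hu
    rw [wordCoeff_word, if_neg]
    rintro rfl
    exact hs ht
  | zero => simp
  | add u v _ _ h h' => rw [map_add, h, h', add_zero]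
  | smul a u _ h => rw [map_smul, h, smul_zero]

lemma BrProd.mono {B : Type} [Ring B] {v : X → B} {L L' : Set X} (hL : L ⊆ L') {n : ℕ} {w : B}
    (h : BrProd v L n w) : BrProd v L' n w := by
  induction h with
  | one => exact .one
  | letter h hx ih => exact ih.letter (hL hx)
  | mul h hb ih => exact ih.mul hb

lemma brProd_word (s : FreeMonoid X) :
    BrProd (ι A) {x | x ∈ s.toList} s.length (word A s) := by
  obtain ⟨l, rfl⟩ : ∃ l, FreeMonoid.ofList l = s := ⟨s.toList, rfl⟩
  induction l using List.reverseRecOn with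
  | nil => exact word_one (A := A) (X := X) ▸ BrProd.one
  | append_singleton l x ih =>
    rw [FreeMonoid.ofList_append, FreeMonoid.ofList_singleton, word_mul, word_of,
      FreeMonoid.length_mul, FreeMonoid.length_of]
    refine (ih.mono fun y hy => ?_).letter ?_ <;> simp_all

/-- The words in a homogeneous element involve finitely many generators. -/
lemma exists_list_brProd_word {m : ℕ} {u : FreeAlgebra A X} (hu : u ∈ degOne A X ^ m) :
    ∃ l : List X, ∀ s, wordCoeff s u ≠ 0 → BrProd (ι A) {x | x ∈ l} m (word A s) := by
  obtain ⟨S, hS, -⟩ := sum_wordCoeff_smul_word u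
  refine ⟨S.toList.flatMap FreeMonoid.toList, fun s hs => ?_⟩
  rw [← length_eq_of_wordCoeff_ne_zero hu hs]
  refine (brProd_word s).mono fun x hx => ?_
  simp only [Set.mem_ofPred_eq, List.mem_flatMap, Finset.mem_toList]
  exact ⟨s, (hS s).2 hs, hx⟩

lemma exists_sum_ι {u : FreeAlgebra A X} (hu : u ∈ degOne A X) :
    ∃ S : Finset X, ∀ S' : Finset X, S ⊆ S' →
      u = ∑ x ∈ S', wordCoeff (FreeMonoid.of x) u • ι A x := by
  classical
  induction hu using Submodule.span_induction with
  | mem u hu =>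
    obtain ⟨x, rfl⟩ := hu
    refine ⟨{x}, fun S' hS' => ?_⟩
    rw [Finset.sum_eq_single x]
    · rw [← word_of, wordCoeff_word, if_pos rfl, one_smul]
    · intro y _ hy
      rw [← word_of, wordCoeff_word, if_neg, zero_smul]
      exact fun h => hy (FreeMonoid.of_injective h).symm
    · exact fun h => absurd (hS' (Finset.mem_singleton_self x)) h
  | zero => exact ⟨∅, by simp⟩
  | add u v _ _ h h' =>
    obtain ⟨S, hS⟩ := h
    obtain ⟨S', hS'⟩ := h'
    refine ⟨S ∪ S', fun S'' h => ?_⟩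
    simp only [map_add, add_smul, Finset.sum_add_distrib]
    rw [← hS S'' (Finset.union_subset_left h), ← hS' S'' (Finset.union_subset_right h)]
  | smul a u _ h =>
    obtain ⟨S, hS⟩ := h
    refine ⟨S, fun S' h => ?_⟩
    simp only [map_smul, smul_assoc]
    rw [← Finset.smul_sum, ← hS S' h]

lemma mem_ideal_smul_top {J : Ideal A} {u : FreeAlgebra A X}
    (hu : u ∈ J • (⊤ : Submodule A (FreeAlgebra A X))) (s : FreeMonoid X) :
    wordCoeff s u ∈ J := by
  induction hu using Submodule.smul_induction_on' with
  | smul a ha u _ => rw [map_smul, smul_eq_mul]; exact J.mul_mem_right _ ha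
  | add u _ v _ h h' => rw [map_add]; exact add_mem h h'

lemma mul_mem_ideal_smul_top {J : Ideal A} {u : FreeAlgebra A X}
    (hu : u ∈ J • (⊤ : Submodule A (FreeAlgebra A X))) (v : FreeAlgebra A X) :
    v * u ∈ J • (⊤ : Submodule A (FreeAlgebra A X)) ∧
      u * v ∈ J • (⊤ : Submodule A (FreeAlgebra A X)) := by
  induction hu using Submodule.smul_induction_on' with
  | smul a ha u _ =>
    rw [mul_smul_comm, smul_mul_assoc]
    exact ⟨Submodule.smul_mem_smul ha trivial, Submodule.smul_mem_smul ha trivial⟩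
  | add u _ v _ h h' =>
    rw [mul_add, add_mul]; exact ⟨add_mem h.1 h'.1, add_mem h.2 h'.2⟩

end Coordinates

section Shift

open FreeAlgebra Polynomial

variable {X A : Type} [CommRing A]

open Classical in
/-- The translation `x ↦ x + t` of the generator `x`, with `t` a central variable. -/
def shift (x : X) : FreeAlgebra A X →ₐ[A] (FreeAlgebra A X)[X] :=
  FreeAlgebra.lift A fun y => C (ι A y) + if y = x then Polynomial.X else 0

open Classical in
lemma shift_ι (x y : X) :
    shift x (ι A y) = C (ι A y) + if y = x then Polynomial.X else 0 := by simp [shift]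

lemma shift_ι_self (x : X) : shift x (ι A x) = C (ι A x) + Polynomial.X := by
  rw [shift_ι, if_pos rfl]

lemma shift_ι_of_ne {x y : X} (h : y ≠ x) : shift x (ι A y) = C (ι A y) := by
  rw [shift_ι, if_neg h, add_zero]

lemma shift_coeff_zero (x : X) (u : FreeAlgebra A X) : (shift x u).coeff 0 = u := by
  induction u using FreeAlgebra.induction with
  | grade0 a => rw [AlgHom.commutes, Polynomial.algebraMap_apply, coeff_C_zero]
  | grade1 y => rw [shift_ι]; split_ifs <;> simp
  | mul u v h h' => rw [map_mul, mul_coeff_zero, h, h']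
  | add u v h h' => rw [map_add, coeff_add, h, h']

/-- The partial derivative with respect to the generator `x`. -/
def pderiv (x : X) : FreeAlgebra A X →ₗ[A] FreeAlgebra A X :=
  Polynomial.lcoeff (FreeAlgebra A X) 1 |>.restrictScalars A |>.comp (shift x).toLinearMap

lemma pderiv_apply (x : X) (u : FreeAlgebra A X) : pderiv x u = (shift x u).coeff 1 := rfl

lemma pderiv_mul (x : X) (u v : FreeAlgebra A X) :
    pderiv x (u * v) = u * pderiv x v + pderiv x u * v := by
  simp only [pderiv_apply, map_mul, mul_coeff_one, shift_coeff_zero]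

lemma pderiv_algebraMap (x : X) (a : A) : pderiv x (algebraMap A (FreeAlgebra A X) a) = 0 := by
  rw [pderiv_apply, AlgHom.commutes, Polynomial.algebraMap_apply, coeff_C_of_ne_zero one_ne_zero]

open Classical in
lemma pderiv_ι (x y : X) : pderiv x (ι A y) = algebraMap A _ (if y = x then 1 else 0) := by
  rw [pderiv_apply, shift_ι]; split_ifs <;> simp

lemma pderiv_degOne (x : X) {u : FreeAlgebra A X} (hu : u ∈ degOne A X) :
    ∃ a : A, pderiv x u = algebraMap A _ a := by
  induction hu using Submodule.span_induction with
  | mem u hu =>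
    obtain ⟨y, rfl⟩ := hu
    exact ⟨_, pderiv_ι x y⟩
  | zero => exact ⟨0, by simp⟩
  | add u v _ _ h h' =>
    obtain ⟨a, ha⟩ := h
    obtain ⟨b, hb⟩ := h'
    exact ⟨a + b, by rw [map_add, ha, hb, map_add]⟩
  | smul c u _ h =>
    obtain ⟨a, ha⟩ := h
    exact ⟨c * a, by rw [map_smul, ha, Algebra.smul_def, map_mul]⟩

lemma pderiv_mem_degOne_pow (x : X) {m : ℕ} {u : FreeAlgebra A X} (hu : u ∈ degOne A X ^ (m + 1)) :
    pderiv x u ∈ degOne A X ^ m := by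
  induction m generalizing u with
  | zero =>
    rw [zero_add, pow_one] at hu
    obtain ⟨a, ha⟩ := pderiv_degOne x hu
    rw [ha, pow_zero]
    exact Submodule.algebraMap_mem _
  | succ m ih =>
    rw [pow_succ] at hu
    induction hu using Submodule.mul_induction_on' with
    | mem_mul_mem u hu v hv =>
      rw [pderiv_mul]
      refine add_mem ?_ ?_
      · obtain ⟨a, ha⟩ := pderiv_degOne x hv
        rw [ha, ← Algebra.commutes, ← Algebra.smul_def]
        exact Submodule.smul_mem _ _ hu
      · rw [pow_succ]
        exact Submodule.mul_mem_mul (ih hu) hv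
    | add u _ v _ h h' => rw [map_add]; exact add_mem h h'

lemma derivative_shift (x : X) (u : FreeAlgebra A X) :
    derivative (shift x u) = shift x (pderiv x u) := by
  induction u using FreeAlgebra.induction with
  | grade0 a => simp [pderiv_algebraMap, Polynomial.algebraMap_apply]
  | grade1 y => rw [pderiv_ι, shift_ι]; split_ifs <;> simp
  | mul u v h h' =>
    rw [map_mul, derivative_mul, h, h', pderiv_mul, map_add, map_mul, map_mul, add_comm]
  | add u v h h' => rw [map_add, map_add, map_add, map_add, h, h']

lemma shift_eq_C_of_pderiv_eq_zero [Algebra ℂ A] (x : X) {u : FreeAlgebra A X}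
    (h : pderiv x u = 0) : shift x u = C u := by
  ext i
  rcases i with _ | i
  · rw [shift_coeff_zero, coeff_C_zero]
  · rw [coeff_C_of_ne_zero (Nat.succ_ne_zero i)]
    have h1 : (derivative (shift x u)).coeff i = 0 := by
      rw [derivative_shift, h, map_zero, coeff_zero]
    rw [coeff_derivative] at h1
    have h2 : ((i : FreeAlgebra A X) + 1) = algebraMap ℂ _ ((i : ℂ) + 1) := by simp
    rw [h2, ← Algebra.commutes, ← Algebra.smul_def] at h1
    have h3 : ((i : ℂ) + 1) ≠ 0 := Nat.cast_add_one_ne_zero i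
    calc _ = ((i : ℂ) + 1)⁻¹ • ((i : ℂ) + 1) • (shift x u).coeff (i + 1) := by
          rw [smul_smul, inv_mul_cancel₀ h3, one_smul]
      _ = 0 := by rw [h1, smul_zero]

lemma shift_isBr (x : X) {n : ℕ} {b : FreeAlgebra A X} (hb : IsBr (ι A) n b) :
    shift x b = C b := by
  have key : ∀ u y, shift x u = C u → shift x (u * ι A y - ι A y * u)
      = C (u * ι A y - ι A y * u) := by
    intro u y hu
    rw [map_sub, map_mul, map_mul, hu, shift_ι, C_sub, C_mul, C_mul]
    split_ifs
    · rw [mul_add, add_mul, X_mul]; abel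
    · simp
  induction hb with
  | two y z =>
    by_cases h : y = x
    · by_cases h' : z = x
      · subst h; subst h'; simp
      · rw [← neg_sub, map_neg, key _ _ (shift_ι_of_ne h'), C_neg]
    · exact key _ _ (shift_ι_of_ne h)
  | succ h y ih => exact key _ _ ih

/-- The substitution of `-x` for the central variable in the translation of `x`: a projection
onto the elements which are invariant under translations of `x`. -/
def invProj (x : X) : FreeAlgebra A X →ₗ[A] FreeAlgebra A X :=
  (Polynomial.lsum fun j => LinearMap.mulLeft A ((-ι A x) ^ j)).comp (shift x).toLinearMap

lemma lsum_mulLeft_mul_C (z : FreeAlgebra A X) (p : (FreeAlgebra A X)[X]) (u : FreeAlgebra A X) :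
    Polynomial.lsum (fun j => LinearMap.mulLeft A (z ^ j)) (p * C u)
      = Polynomial.lsum (fun j => LinearMap.mulLeft A (z ^ j)) p * u := by
  induction p using Polynomial.induction_on' with
  | add p q h h' => rw [add_mul, map_add, h, h', map_add, add_mul]
  | monomial n a =>
    rw [monomial_mul_C]
    simp [Polynomial.lsum_apply, sum_monomial_index, mul_assoc]

lemma lsum_mulLeft_mul_X (z : FreeAlgebra A X) (p : (FreeAlgebra A X)[X]) :
    Polynomial.lsum (fun j => LinearMap.mulLeft A (z ^ j)) (p * Polynomial.X)
      = z * Polynomial.lsum (fun j => LinearMap.mulLeft A (z ^ j)) p := by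
  induction p using Polynomial.induction_on' with
  | add p q h h' => rw [add_mul, map_add, h, h', map_add, mul_add]
  | monomial n a =>
    rw [monomial_mul_X]
    simp [Polynomial.lsum_apply, sum_monomial_index, pow_succ', mul_assoc]

lemma invProj_eq_self {x : X} {u : FreeAlgebra A X} (h : shift x u = C u) : invProj x u = u := by
  simp [invProj, h, Polynomial.lsum_apply, sum_C_index]

lemma invProj_mul {x : X} (u : FreeAlgebra A X) {v : FreeAlgebra A X} (h : shift x v = C v) :
    invProj x (u * v) = invProj x u * v := by
  simp only [invProj, LinearMap.comp_apply, AlgHom.toLinearMap_apply, map_mul, h]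
  exact lsum_mulLeft_mul_C _ _ _

lemma invProj_mul_ι (x : X) (u : FreeAlgebra A X) :
    invProj x (u * ι A x) = invProj x u * ι A x - ι A x * invProj x u := by
  simp only [invProj, LinearMap.comp_apply, AlgHom.toLinearMap_apply, map_mul, shift_ι_self,
    mul_add, map_add]
  rw [lsum_mulLeft_mul_C, lsum_mulLeft_mul_X, neg_mul, sub_eq_add_neg]

lemma invProj_brProd (x : X) {L L' : Set X} (hL : L ⊆ insert x L') {m : ℕ} {w : FreeAlgebra A X}
    (h : BrProd (ι A) L m w) : invProj x w ∈ Submodule.span A {u | BrProd (ι A) L' m u} := by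
  have hmul : ∀ {n k : ℕ} {c : FreeAlgebra A X},
      (∀ u, BrProd (ι A) L' n u → BrProd (ι A) L' k (u * c)) →
      ∀ u ∈ Submodule.span A {u | BrProd (ι A) L' n u},
        u * c ∈ Submodule.span A {u | BrProd (ι A) L' k u} := by
    intro n k c hc u hu
    induction hu using Submodule.span_induction with
    | mem u hu => exact Submodule.subset_span (hc u hu)
    | zero => simp
    | add u v _ _ h h' => rw [add_mul]; exact add_mem h h'
    | smul a u _ h => rw [smul_mul_assoc]; exact Submodule.smul_mem _ _ h
  have hcomm : ∀ {n : ℕ}, ∀ u ∈ Submodule.span A {u | BrProd (ι A) L' n u},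
      u * ι A x - ι A x * u ∈ Submodule.span A {u | BrProd (ι A) L' (n + 1) u} := by
    intro n u hu
    induction hu using Submodule.span_induction with
    | mem u hu =>
      exact (AddSubgroup.closure_le (Submodule.span A _).toAddSubgroup).2
        (fun y hy => Submodule.subset_span hy) (hu.commutator x)
    | zero => simp
    | add u v _ _ h h' => rw [add_mul, mul_add, add_sub_add_comm]; exact add_mem h h'
    | smul a u _ h =>
      rw [smul_mul_assoc, mul_smul_comm, ← smul_sub]; exact Submodule.smul_mem _ _ h
  induction h with
  | one =>
    rw [invProj_eq_self (by simp)]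
    exact Submodule.subset_span .one
  | @letter n t h y hy ih =>
    by_cases hyx : y = x
    · subst hyx
      rw [invProj_mul_ι]
      exact hcomm _ ih
    · rw [invProj_mul _ (shift_ι_of_ne hyx)]
      exact hmul (fun u hu => hu.letter ((hL hy).resolve_left hyx)) _ ih
  | mul h hb ih =>
    rw [invProj_mul _ (shift_isBr x hb)]
    exact hmul (fun u hu => hu.mul hb) _ ih

/-- The composition of the projections `invProj x` for `x` in a list. -/
def invProjList : List X → FreeAlgebra A X →ₗ[A] FreeAlgebra A X
  | [] => LinearMap.id
  | x :: l => (invProjList l).comp (invProj x)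

lemma invProjList_eq_self (l : List X) {u : FreeAlgebra A X} (h : ∀ x, shift x u = C u) :
    invProjList l u = u := by
  induction l with
  | nil => rfl
  | cons x l ih => rw [invProjList, LinearMap.comp_apply, invProj_eq_self (h x), ih]

lemma invProjList_mem (l : List X) {m : ℕ} {w : FreeAlgebra A X}
    (h : BrProd (ι A) {x | x ∈ l} m w) : invProjList l w ∈ brModule A X m := by
  have : ∀ w ∈ Submodule.span A {w | BrProd (ι A) {x | x ∈ l} m w},
      invProjList l w ∈ brModule A X m := by
    clear h w
    induction l with
    | nil =>
      intro w hw
      rw [brModule]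
      simpa [invProjList] using hw
    | cons x l ih =>
      intro w hw
      rw [invProjList, LinearMap.comp_apply]
      refine ih _ ?_
      induction hw using Submodule.span_induction with
      | mem w hw => exact invProj_brProd x (by intro y hy; simpa using hy) hw
      | zero => simp
      | add u v _ _ h h' => rw [map_add]; exact add_mem h h'
      | smul a u _ h => rw [map_smul]; exact Submodule.smul_mem _ _ h
  exact this w (Submodule.subset_span h)

end Shift

section Minors

open FreeAlgebra Polynomial

variable {X A : Type} [CommRing A]

/-- The ideal of `2 × 2` minors of the matrix of coefficients of `δ`. -/
def minorIdeal (δ : X → FreeAlgebra A X) : Ideal A :=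
  Ideal.span {c | ∃ a b x y, c = wordCoeff (FreeMonoid.of x) (δ a) * wordCoeff (FreeMonoid.of y) (δ b)
    - wordCoeff (FreeMonoid.of x) (δ b) * wordCoeff (FreeMonoid.of y) (δ a)}

variable {δ : X → FreeAlgebra A X}

lemma commutator_δ_mem (hδ : ∀ b, δ b ∈ degOne A X) (a b : X) :
    δ a * δ b - δ b * δ a ∈ minorIdeal δ • (⊤ : Submodule A (FreeAlgebra A X)) := by
  classical
  obtain ⟨S, hS⟩ := exists_sum_ι (hδ a)
  obtain ⟨S', hS'⟩ := exists_sum_ι (hδ b)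
  have h1 := hS (S ∪ S') Finset.subset_union_left
  have h2 := hS' (S ∪ S') Finset.subset_union_right
  have : δ a * δ b - δ b * δ a = ∑ x ∈ S ∪ S', ∑ y ∈ S ∪ S',
      (wordCoeff (FreeMonoid.of x) (δ a) * wordCoeff (FreeMonoid.of y) (δ b)
        - wordCoeff (FreeMonoid.of x) (δ b) * wordCoeff (FreeMonoid.of y) (δ a))
        • (ι A x * ι A y) := by
    conv_lhs => rw [h1, h2]
    rw [Finset.sum_mul_sum, Finset.sum_mul_sum, ← Finset.sum_sub_distrib]
    refine Finset.sum_congr rfl fun x _ => ?_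
    rw [← Finset.sum_sub_distrib]
    refine Finset.sum_congr rfl fun y _ => ?_
    rw [smul_mul_smul_comm, smul_mul_smul_comm, sub_smul]
  rw [this]
  exact Submodule.sum_mem _ fun x _ => Submodule.sum_mem _ fun y _ =>
    Submodule.smul_mem_smul (Ideal.subset_span ⟨a, b, x, y, rfl⟩) trivial

lemma lift_isBr_mem (hδ : ∀ b, δ b ∈ degOne A X) {n : ℕ} {b : FreeAlgebra A X}
    (hb : IsBr (ι A) n b) :
    FreeAlgebra.lift A δ b ∈ minorIdeal δ • (⊤ : Submodule A (FreeAlgebra A X)) := by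
  induction hb with
  | two x y => simpa using commutator_δ_mem hδ x y
  | succ h x ih =>
    rw [map_sub, map_mul, map_mul]
    exact sub_mem (mul_mem_ideal_smul_top ih _).2 (mul_mem_ideal_smul_top ih _).1

lemma lift_brModule_mem (hδ : ∀ b, δ b ∈ degOne A X) {n : ℕ} (hn : n ≠ 0) {w : FreeAlgebra A X}
    (hw : w ∈ brModule A X n) :
    FreeAlgebra.lift A δ w ∈ minorIdeal δ • (⊤ : Submodule A (FreeAlgebra A X)) := by
  induction hw using Submodule.span_induction with
  | mem w hw =>
    cases hw with
    | one => exact absurd rfl hn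
    | letter h hx => exact absurd hx (Set.notMem_empty _)
    | mul h hb => rw [map_mul]; exact (mul_mem_ideal_smul_top (lift_isBr_mem hδ hb) _).1
  | zero => simp
  | add u v _ _ h h' => rw [map_add]; exact add_mem h h'
  | smul a u _ h => rw [map_smul]; exact Submodule.smul_mem _ _ h

lemma commutator_mem_degOne_pow {m k : ℕ} {u v : FreeAlgebra A X} (hu : u ∈ degOne A X ^ m)
    (hv : v ∈ degOne A X ^ k) : u * v - v * u ∈ degOne A X ^ (m + k) := by
  refine sub_mem ?_ ?_
  · rw [pow_add]; exact Submodule.mul_mem_mul hu hv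
  · rw [add_comm, pow_add]; exact Submodule.mul_mem_mul hv hu

lemma ι_mem_degOne (x : X) : ι A x ∈ degOne A X ^ 1 := by
  rw [pow_one]; exact Submodule.subset_span ⟨x, rfl⟩

lemma brModule_le_degOne_pow (m : ℕ) : brModule A X m ≤ degOne A X ^ m := by
  rw [brModule, Submodule.span_le]
  intro w hw
  have hbr : ∀ {n b}, IsBr (ι A : X → _) n b → b ∈ degOne A X ^ n := by
    intro n b hb
    induction hb with
    | two x y => exact commutator_mem_degOne_pow (ι_mem_degOne x) (ι_mem_degOne y)
    | succ h x ih => exact commutator_mem_degOne_pow ih (ι_mem_degOne x)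
  induction hw with
  | one => rw [pow_zero]; exact Submodule.one_le.1 le_rfl
  | letter h hx => exact absurd hx (Set.notMem_empty _)
  | mul h hb ih => rw [pow_add]; exact Submodule.mul_mem_mul ih (hbr hb)

lemma lift_eq_self_of_mem_range (hδδ : ∀ b, FreeAlgebra.lift A δ (δ b) = δ b)
    {u : FreeAlgebra A X} (hu : u ∈ (FreeAlgebra.lift A δ).range) : FreeAlgebra.lift A δ u = u := by
  obtain ⟨v, rfl⟩ := hu
  have : (FreeAlgebra.lift A δ).comp (FreeAlgebra.lift A δ) = FreeAlgebra.lift A δ := by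
    ext x; simp [hδδ]
  exact AlgHom.congr_fun this v

lemma shift_isBr_δ (hδ : ∀ b, δ b ∈ degOne A X) (x : X) {n : ℕ} {w : FreeAlgebra A X}
    (hw : IsBr δ n w) : shift x w = C w := by
  have hx : ∀ {u : FreeAlgebra A X}, u ∈ degOne A X → ∃ a : A, shift x u = C u + a • Polynomial.X := by
    intro u hu
    induction hu using Submodule.span_induction with
    | mem u hu =>
      obtain ⟨y, rfl⟩ := hu
      by_cases h : y = x
      · exact ⟨1, by rw [h, shift_ι_self, one_smul]⟩
      · exact ⟨0, by rw [shift_ι_of_ne h, zero_smul, add_zero]⟩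
    | zero => exact ⟨0, by simp⟩
    | add u v _ _ h h' =>
      obtain ⟨a, ha⟩ := h
      obtain ⟨b, hb⟩ := h'
      exact ⟨a + b, by rw [map_add, ha, hb, C_add, add_smul]; abel⟩
    | smul c u _ h =>
      obtain ⟨a, ha⟩ := h
      exact ⟨c * a, by rw [map_smul, ha, smul_add, smul_smul, smul_C]⟩
  have key : ∀ u v, shift x u = C u → v ∈ degOne A X → shift x (u * v - v * u)
      = C (u * v - v * u) := by
    intro u v hu hv
    obtain ⟨a, ha⟩ := hx hv
    rw [map_sub, map_mul, map_mul, hu, ha, C_sub, C_mul, C_mul, mul_add, add_mul, mul_smul_comm,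
      smul_mul_assoc, X_mul]
    abel
  induction hw with
  | two y z =>
    obtain ⟨a, ha⟩ := hx (hδ y)
    obtain ⟨b, hb⟩ := hx (hδ z)
    simp only [map_sub, map_mul, ha, hb, mul_add, add_mul, mul_smul_comm, smul_mul_assoc, X_mul,
      smul_add, smul_smul, mul_comm b a]
    abel
  | succ h y ih => exact key _ _ ih (hδ y)

lemma shift_lift_brModule (hδ : ∀ b, δ b ∈ degOne A X) (x : X) {n : ℕ} {w : FreeAlgebra A X}
    (hw : w ∈ brModule A X n) :
    shift x (FreeAlgebra.lift A δ w) = C (FreeAlgebra.lift A δ w) := by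
  induction hw using Submodule.span_induction with
  | mem w hw =>
    have h1 := hw.map (FreeAlgebra.lift A δ).toRingHom
    have h2 : (fun x => (FreeAlgebra.lift A δ).toRingHom (ι A x)) = δ := by ext x; simp
    rw [h2] at h1
    change BrProd δ ∅ n (FreeAlgebra.lift A δ w) at h1
    generalize FreeAlgebra.lift A δ w = u at h1
    clear hw h2
    induction h1 with
    | one => simp
    | letter h hx => exact absurd hx (Set.notMem_empty _)
    | mul h hb ih => rw [map_mul, ih, shift_isBr_δ hδ x hb, C_mul]
  | zero => simp
  | add u v _ _ h h' => rw [map_add, map_add, h, h', C_add]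
  | smul a u _ h => rw [map_smul, map_smul, h, smul_C]

/-- An element of the ideal of minors acts as the identity on the image of a bracket. -/
lemma exists_smul_eq_zero (hδ : ∀ b, δ b ∈ degOne A X)
    (hδδ : ∀ b, FreeAlgebra.lift A δ (δ b) = δ b) {n : ℕ} (hn : n ≠ 0) {w : FreeAlgebra A X}
    (hw : w ∈ brModule A X n) :
    ∃ k ∈ minorIdeal δ, (1 - k) • FreeAlgebra.lift A δ w = 0 := by
  set u := FreeAlgebra.lift A δ w with hu
  have hu1 : u ∈ degOne A X ^ n := lift_mem_degOne_pow hδ (brModule_le_degOne_pow n hw)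
  obtain ⟨l, hl⟩ := exists_list_brProd_word hu1
  have hu2 : FreeAlgebra.lift A δ (invProjList l u) = u := by
    rw [invProjList_eq_self l fun x => shift_lift_brModule hδ x hw]
    exact lift_eq_self_of_mem_range hδδ ⟨w, rfl⟩
  obtain ⟨S, hS, hSu⟩ := sum_wordCoeff_smul_word u
  let N : Ideal A := Ideal.span ((fun s => wordCoeff s u) '' S)
  have hN : ∀ s, wordCoeff s u ∈ N := by
    intro s
    by_cases hs : wordCoeff s u = 0
    · rw [hs]; exact zero_mem _
    · exact Ideal.subset_span ⟨s, (hS s).2 hs, rfl⟩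
  have hNN : N ≤ minorIdeal δ • N := by
    refine Ideal.span_le.2 ?_
    rintro _ ⟨t, -, rfl⟩
    have : wordCoeff t u = ∑ s ∈ S, wordCoeff s u *
        wordCoeff t (FreeAlgebra.lift A δ (invProjList l (word A s))) := by
      conv_lhs => rw [← hu2]
      conv_lhs => rw [← hSu]
      simp only [map_sum, map_smul, smul_eq_mul]
    simp only
    rw [this]
    refine Submodule.sum_mem _ fun s hs => ?_
    rw [mul_comm]
    exact Submodule.smul_mem_smul (mem_ideal_smul_top (lift_brModule_mem hδ hn
      (invProjList_mem l (hl s ((hS s).1 hs)))) t) (hN s)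
  obtain ⟨r, hr, hr0⟩ := Submodule.exists_sub_one_mem_and_smul_eq_zero_of_fg_of_le_smul
    (minorIdeal δ) N ⟨(S.finite_toSet.image fun s => wordCoeff s u).toFinset, by simp [N, Ideal.span]⟩ hNN
  refine ⟨1 - r, by rw [← neg_sub]; exact neg_mem hr, ext_wordCoeff fun s => ?_⟩
  rw [sub_sub_cancel, map_smul, hr0 _ (hN s), map_zero]

lemma exists_smul_eq_zero_pair (hδ : ∀ b, δ b ∈ degOne A X)
    (hδδ : ∀ b, FreeAlgebra.lift A δ (δ b) = δ b) {n m : ℕ} (hn : n ≠ 0) (hm : m ≠ 0)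
    {w w' : FreeAlgebra A X} (hw : w ∈ brModule A X n) (hw' : w' ∈ brModule A X m) :
    ∃ k ∈ minorIdeal δ, k • FreeAlgebra.lift A δ w = FreeAlgebra.lift A δ w ∧
      k • FreeAlgebra.lift A δ w' = FreeAlgebra.lift A δ w' := by
  obtain ⟨k, hk, h⟩ := exists_smul_eq_zero hδ hδδ hn hw
  obtain ⟨k', hk', h'⟩ := exists_smul_eq_zero hδ hδδ hm hw'
  refine ⟨k + k' - k * k', sub_mem (add_mem hk hk') (Ideal.mul_mem_left _ _ hk'), ?_, ?_⟩
  · have : k + k' - k * k' = 1 - (1 - k') * (1 - k) := by ring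
    rw [this, sub_smul, one_smul, mul_smul, h, smul_zero, sub_zero]
  · have : k + k' - k * k' = 1 - (1 - k) * (1 - k') := by ring
    rw [this, sub_smul, one_smul, mul_smul, h', smul_zero, sub_zero]

lemma wordCoeff_lift_eq_sum (hδ : ∀ b, δ b ∈ degOne A X)
    (hδδ : ∀ b, FreeAlgebra.lift A δ (δ b) = δ b) (v : FreeAlgebra A X) :
    ∃ S : Finset X, ∀ S' : Finset X, S ⊆ S' → ∀ x s,
      wordCoeff (FreeMonoid.of x * s) (FreeAlgebra.lift A δ v) = ∑ t ∈ S',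
        wordCoeff (FreeMonoid.of t * s) (FreeAlgebra.lift A δ v)
          * wordCoeff (FreeMonoid.of x) (δ t) := by
  classical
  induction v using word_induction with
  | word s =>
    induction s using FreeMonoid.casesOn with
    | one =>
      refine ⟨∅, fun S' _ x s => ?_⟩
      have : ∀ y : X, wordCoeff (FreeMonoid.of y * s) (1 : FreeAlgebra A X) = 0 := by
        intro y
        rw [← word_one, wordCoeff_word, if_neg]
        intro h
        have := congrArg FreeMonoid.length h
        rw [FreeMonoid.length_mul, FreeMonoid.length_of, FreeMonoid.length_one] at this
        omega
      simp [word_one, this]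
    | of_mul b s =>
      obtain ⟨S, hS⟩ := exists_sum_ι (hδ b)
      refine ⟨S, fun S' h x s' => ?_⟩
      rw [word_mul, word_of, map_mul, FreeAlgebra.lift_ι_apply]
      simp only [wordCoeff_degOne_mul _ _ _ (hδ b)]
      have h1 := congrArg (FreeAlgebra.lift A δ) (hS S' h)
      rw [hδδ, map_sum] at h1
      simp only [map_smul, FreeAlgebra.lift_ι_apply] at h1
      conv_lhs => rw [h1]
      rw [map_sum, Finset.sum_mul]
      refine Finset.sum_congr rfl fun t _ => ?_
      rw [map_smul, smul_eq_mul]; ring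
  | zero => exact ⟨∅, by simp⟩
  | add u v h h' =>
    obtain ⟨S, hS⟩ := h
    obtain ⟨S', hS'⟩ := h'
    refine ⟨S ∪ S', fun S'' h x s => ?_⟩
    simp only [map_add, add_mul, Finset.sum_add_distrib]
    rw [← hS S'' (Finset.union_subset_left h), ← hS' S'' (Finset.union_subset_right h)]
  | smul a u h =>
    obtain ⟨S, hS⟩ := h
    refine ⟨S, fun S' h x s => ?_⟩
    simp only [map_smul, smul_eq_mul, mul_assoc]
    rw [← Finset.mul_sum, ← hS S' h]

/-- Elements of positive order commuting with every `δ b` are killed by the minors of `δ`. -/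
lemma smul_eq_zero_of_commute (hδ : ∀ b, δ b ∈ degOne A X)
    (hδδ : ∀ b, FreeAlgebra.lift A δ (δ b) = δ b) {w : FreeAlgebra A X}
    (hw : w ∈ (FreeAlgebra.lift A δ).range) (hw0 : wordCoeff 1 w = 0)
    (hcomm : ∀ b, w * δ b = δ b * w) {c : A} (hc : c ∈ minorIdeal δ) : c • w = 0 := by
  let e : X → X → A := fun b x => wordCoeff (FreeMonoid.of x) (δ b)
  have h1 : ∀ b x y s, wordCoeff (FreeMonoid.of x * s) w * e b y
      = e b x * wordCoeff (s * FreeMonoid.of y) w := by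
    intro b x y s
    rw [← wordCoeff_mul_degOne _ _ _ (hδ b), ← wordCoeff_degOne_mul _ _ _ (hδ b), hcomm, mul_assoc]
  have h2 : ∀ a b x y s, wordCoeff (FreeMonoid.of x * s) w * (e a y * e b x - e b y * e a x) = 0 := by
    intro a b x y s
    linear_combination e b x * h1 a x y s - e a x * h1 b x y s
  have h3 : ∀ b x s, c * (e b x * wordCoeff (FreeMonoid.of x * s) w) = 0 := by
    intro d x s
    induction hc using Submodule.span_induction with
    | mem c hc =>
      obtain ⟨a, b, y, z, rfl⟩ := hc
      change (e a y * e b z - e b y * e a z) * _ = 0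
      linear_combination e b z * h2 a d x y s + e d y * h2 b a x z s + e a z * h2 d b x y s
    | zero => simp
    | add c c' _ _ h h' => rw [add_mul, h, h', add_zero]
    | smul a c _ h => rw [smul_eq_mul, mul_assoc, h, mul_zero]
  have h4 : ∀ t (s : FreeMonoid X) p, ∃ a, e t t ^ s.length *
      wordCoeff (s * FreeMonoid.of t ^ p) w = a * wordCoeff (FreeMonoid.of t ^ (p + s.length)) w := by
    intro t s
    induction s using FreeMonoid.inductionOn' with
    | one => intro p; exact ⟨1, by simp⟩
    | of_mul x s ih =>
      intro p
      obtain ⟨a, ha⟩ := ih (p + 1)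
      refine ⟨e t x * a, ?_⟩
      have := h1 t x t (s * FreeMonoid.of t ^ p)
      rw [mul_assoc s, ← pow_succ] at this
      rw [FreeMonoid.length_mul, FreeMonoid.length_of, mul_assoc (FreeMonoid.of x),
        show p + (1 + s.length) = p + 1 + s.length by ring]
      linear_combination e t x * ha + e t t ^ s.length * this
  have h5 : ∀ t (s : FreeMonoid X), s.length ≠ 0 →
      e t t ^ (s.length + 1) * (c * wordCoeff s w) = 0 := by
    intro t s hs
    obtain ⟨a, ha⟩ := h4 t s 0
    obtain ⟨n, hn⟩ := Nat.exists_eq_succ_of_ne_zero hs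
    have h6 := h3 t t (FreeMonoid.of t ^ n)
    rw [← pow_succ', ← Nat.succ_eq_add_one, ← hn] at h6
    rw [zero_add, pow_zero, mul_one] at ha
    linear_combination e t t * c * ha + a * h6
  obtain ⟨v, rfl⟩ := hw
  obtain ⟨S, hS⟩ := wordCoeff_lift_eq_sum hδ hδδ v
  replace hS := hS S subset_rfl
  generalize FreeAlgebra.lift A δ v = w at *
  let τ : A := ∑ t ∈ S, e t t
  have h6 : ∀ x s, wordCoeff (FreeMonoid.of x * s) w = τ * wordCoeff (s * FreeMonoid.of x) w := by
    intro x s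
    rw [hS, Finset.sum_mul]
    exact Finset.sum_congr rfl fun t _ => h1 t t x s
  refine ext_wordCoeff fun s => ?_
  rw [map_smul, map_zero, smul_eq_mul]
  by_cases hs : s.length = 0
  · rw [FreeMonoid.length_eq_zero.1 hs, hw0, mul_zero]
  have h7 : ∃ k, ∀ s' : FreeMonoid X, s'.length = s.length → τ ^ k * (c * wordCoeff s' w) = 0 := by
    let J : Ideal A := ⨅ s' : {s' : FreeMonoid X // s'.length = s.length},
      (Submodule.span A {c * wordCoeff s'.1 w}).annihilator
    have hJ : ∀ a : A, a ∈ J ↔ ∀ s' : FreeMonoid X, s'.length = s.length →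
        a * (c * wordCoeff s' w) = 0 := by
      intro a
      simp only [J, Submodule.mem_iInf, Submodule.mem_annihilator_span_singleton, smul_eq_mul,
        Subtype.forall]
    have : τ ∈ J.radical := by
      refine Ideal.sum_mem _ fun t _ => ⟨s.length + 1, (hJ _).2 fun s' hs' => ?_⟩
      rw [← hs']
      exact h5 t s' (by rwa [hs'])
    obtain ⟨k, hk⟩ := this
    exact ⟨k, (hJ _).1 hk⟩
  obtain ⟨k, hk⟩ := h7
  induction k with
  | zero => simpa using hk s rfl
  | succ k ih =>
    refine ih fun s' hs' => ?_
    induction s' using FreeMonoid.casesOn with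
    | one => exact absurd hs'.symm (by simpa using hs)
    | of_mul x s' =>
      rw [h6]
      have := hk (s' * FreeMonoid.of x) (by
        rw [← hs', FreeMonoid.length_mul, FreeMonoid.length_mul, add_comm])
      linear_combination this

lemma wordCoeff_one_eq_zero {m : ℕ} (hm : m ≠ 0) {u : FreeAlgebra A X}
    (hu : u ∈ degOne A X ^ m) : wordCoeff 1 u = 0 := by
  by_contra h
  exact hm (length_eq_of_wordCoeff_ne_zero hu h).symm

lemma pderiv_mem_range (hδ : ∀ b, δ b ∈ degOne A X) (x : X) {u : FreeAlgebra A X}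
    (hu : u ∈ (FreeAlgebra.lift A δ).range) : pderiv x u ∈ (FreeAlgebra.lift A δ).range := by
  obtain ⟨v, rfl⟩ := hu
  change pderiv x (FreeAlgebra.lift A δ v) ∈ _
  induction v using FreeAlgebra.induction with
  | grade0 a => rw [AlgHom.commutes, pderiv_algebraMap]; exact zero_mem _
  | grade1 b =>
    obtain ⟨a, ha⟩ := pderiv_degOne x (hδ b)
    rw [FreeAlgebra.lift_ι_apply, ha]
    exact Subalgebra.algebraMap_mem _ _
  | mul u v h h' =>
    rw [map_mul, pderiv_mul]
    exact add_mem (mul_mem ⟨u, rfl⟩ h') (mul_mem h ⟨v, rfl⟩)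
  | add u v h h' => rw [map_add, map_add]; exact add_mem h h'

end Minors

section AlmostCentral

open FreeAlgebra Polynomial

variable {R A : Type} [Ring R] [Algebra ℂ R] [CommRing A] [Algebra ℂ A] {π : R →ₐ[ℂ] A} {N : ℕ}

namespace TaylorData

variable (D : TaylorData π N)

lemma φ_sub {i : ℕ} (hi : i < N) (r s : R) : D.φ i (r - s) = D.φ i r - D.φ i s := by
  rw [eq_sub_iff_add_eq, ← D.φ_add i hi, sub_add_cancel]

lemma smul_φ_commutator {a : A} {i : ℕ} (hiN : i + 1 < N) {z : R}
    (h : ∀ p, 1 ≤ p → p < i → a • D.φ p z = 0) (b : R) :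
    a • D.φ (i + 1) (z * b - b * z) = a • (D.φ i z * D.δ b - D.δ b * D.φ i z) := by
  rw [D.φ_sub hiN, D.φ_mul _ hiN, D.φ_mul _ hiN,
    ← Finset.Nat.sum_antidiagonal_swap (f := fun x : ℕ × ℕ => D.φ x.1 b * D.φ x.2 z),
    ← Finset.sum_sub_distrib, Finset.smul_sum, Finset.sum_eq_single (i, 1)]
  · simp only [Prod.swap, D.φ_one]
  · rintro ⟨p, q⟩ hpq hne
    rw [Finset.HasAntidiagonal.mem_antidiagonal] at hpq
    simp only [Prod.swap] at hpq ⊢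
    rcases Nat.eq_zero_or_pos p with rfl | hp
    · rw [D.φ_zero, Algebra.commutes, sub_self, smul_zero]
    rcases Nat.eq_zero_or_pos q with rfl | hq
    · rw [D.φ_zero, Algebra.commutes, sub_self, smul_zero]
    have hpi : p < i := by
      by_contra hcon
      exact hne (Prod.ext (by simp only; omega) (by simp only; omega))
    rw [smul_sub, ← smul_mul_assoc, ← mul_smul_comm, h p hp hpi, zero_mul, mul_zero, sub_self]
  · intro hne
    exact absurd (Finset.HasAntidiagonal.mem_antidiagonal.2 (by rfl)) hne

end TaylorData

/-- An element which is central up to order `m + 1` can be corrected in order `m` so as to become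
central up to order `m + 2`. -/
theorem exists_sub_commutator_mem (hR : IsNCSmooth R) (hπ : IsAbelianization π) {m : ℕ}
    (hm : 2 ≤ m) {z : R} (hz : ∀ b, z * b - b * z ∈ commFiltration R (m + 1)) :
    ∃ r ∈ commFiltration R m,
      ∀ b, (z - r) * b - b * (z - r) ∈ commFiltration R (m + 2) := by
  obtain ⟨D⟩ := nonempty_taylorData hR hπ (by omega : 2 ≤ m + 2)
  have hlow : ∀ k ∈ minorIdeal D.δ, ∀ i, 1 ≤ i → i < m → k ^ i • D.φ i z = 0 := by
    intro k hk i
    induction i using Nat.strong_induction_on with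
    | _ i ih =>
      intro hi him
      obtain ⟨j, rfl⟩ : ∃ j, i = j + 1 := ⟨i - 1, by omega⟩
      rw [pow_succ', mul_smul]
      refine smul_eq_zero_of_commute D.δ_mem D.subst_δ
        (Subalgebra.smul_mem _ (D.φ_range _ _) _) ?_ (fun b => ?_) hk
      · rw [map_smul, wordCoeff_one_eq_zero (Nat.succ_ne_zero j) (D.φ_pow _ _), smul_zero]
      · have := D.smul_φ_commutator (a := k ^ j) (i := j + 1) (by omega) (z := z) (fun p hp hpj => by
          obtain ⟨c, rfl⟩ := Nat.exists_eq_add_of_le (Nat.lt_succ_iff.1 hpj)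
          rw [pow_add, mul_comm, mul_smul, ih p hpj hp (by omega), smul_zero]) b
        rw [D.φ_eq_zero _ _ (hz b) _ (by omega) (by omega), smul_zero, eq_comm, smul_sub,
          sub_eq_zero] at this
        rw [smul_mul_assoc, mul_smul_comm, this]
  set y := D.φ m z with hy
  obtain ⟨j, rfl⟩ : ∃ j, m = j + 1 := ⟨m - 1, by omega⟩
  choose u hu hDu using fun b => D.φ_mem (j + 1 + 1) _ (by omega) (by omega) (hz b)
  have htop : ∀ k ∈ minorIdeal D.δ, ∀ b, k ^ j • D.φ (j + 1 + 1) (z * b - b * z)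
      = k ^ j • (y * D.δ b - D.δ b * y) := by
    intro k hk b
    refine D.smul_φ_commutator (by omega) (fun p hp hpj => ?_) b
    obtain ⟨c, rfl⟩ := Nat.exists_eq_add_of_le (Nat.lt_succ_iff.1 hpj)
    rw [pow_add, mul_comm, mul_smul, hlow k hk p hp (by omega), smul_zero]
  have hshift : ∀ k ∈ minorIdeal D.δ, ∀ x, shift x (k ^ (j + 1) • y) = C (k ^ (j + 1) • y) := by
    intro k hk x
    refine shift_eq_C_of_pderiv_eq_zero x ?_
    rw [map_smul, pow_succ', mul_smul]
    refine smul_eq_zero_of_commute D.δ_mem D.subst_δ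
      (Subalgebra.smul_mem _ (pderiv_mem_range D.δ_mem x (D.φ_range _ _)) _) ?_ (fun b => ?_) hk
    · rw [map_smul, wordCoeff_one_eq_zero (by omega : j ≠ 0)
        (pderiv_mem_degOne_pow x (D.φ_pow _ _)), smul_zero]
    · have h1 := congrArg (pderiv x) (htop k hk b)
      obtain ⟨a, ha⟩ := pderiv_degOne x (D.δ_mem b)
      rw [map_smul, hDu, pderiv_apply, shift_lift_brModule D.δ_mem x (hu b),
        coeff_C_of_ne_zero one_ne_zero, smul_zero, map_smul, map_sub, pderiv_mul, pderiv_mul, ha,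
        ← Algebra.commutes a y, add_comm (D.δ b * _), add_sub_add_left_eq_sub, smul_sub, eq_comm,
        sub_eq_zero] at h1
      rw [smul_mul_assoc, mul_smul_comm, h1]
  obtain ⟨l, hl⟩ := exists_list_brProd_word (D.φ_pow (j + 1) z)
  have hv : invProjList l y ∈ brModule A R (j + 1) := by
    obtain ⟨S, hS, hSy⟩ := sum_wordCoeff_smul_word y
    rw [← hSy, map_sum]
    refine Submodule.sum_mem _ fun s hs => ?_
    rw [map_smul]
    exact Submodule.smul_mem _ _ (invProjList_mem l (hl s ((hS s).1 hs)))
  obtain ⟨r, hr, hrv⟩ := D.exists_of_mem (j + 1) _ hm (by omega) hv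
  have hk' : ∀ k ∈ minorIdeal D.δ, k ^ (j + 1) • FreeAlgebra.lift A D.δ (invProjList l y)
      = k ^ (j + 1) • y := by
    intro k hk
    rw [← map_smul, ← map_smul, invProjList_eq_self l (hshift k hk)]
    exact lift_eq_self_of_mem_range D.subst_δ (Subalgebra.smul_mem _ (D.φ_range _ _) _)
  refine ⟨r, hr, fun b => ?_⟩
  have e : (z - r) * b - b * (z - r) = (z * b - b * z) - (r * b - b * r) := by noncomm_ring
  have hmem : (z - r) * b - b * (z - r) ∈ commFiltration R (j + 1 + 1) := by
    rw [e]; exact sub_mem (hz b) (commutator_mem_succ hr b)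
  refine D.mem_succ _ _ (by omega) (by omega) hmem ?_
  obtain ⟨k, hk, hk1, hk2⟩ := exists_smul_eq_zero_pair D.δ_mem D.subst_δ (by omega) (by omega)
    (hu b) hv
  have hpow : ∀ t : FreeAlgebra A R, k • t = t → ∀ i, k ^ i • t = t := by
    intro t ht i
    induction i with
    | zero => simp
    | succ i ih => rw [pow_succ, mul_smul, ht, ih]
  have h2 := D.smul_φ_commutator (a := 1) (i := j + 1) (by omega) (z := r) (fun p hp hpj => by
    rw [D.φ_eq_zero _ _ hr _ hpj (by omega), smul_zero]) b
  rw [one_smul, one_smul, hrv] at h2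
  have h3 := congrArg (k • ·) (htop k hk b)
  simp only [smul_smul, ← pow_succ'] at h3
  rw [hDu, hpow _ hk1, smul_sub, ← smul_mul_assoc, ← mul_smul_comm, ← hk' k hk, hpow _ hk2] at h3
  rw [e, D.φ_sub (by omega), h2, hDu, h3, sub_self]

end AlmostCentral

section Completion

variable {R : Type} [Ring R] [Algebra ℂ R]

/-- In an NC-smooth algebra, elements which are central to high order are close to the center. -/
theorem exists_central_sub_mem {A : Type} [CommRing A] [Algebra ℂ A] {π : R →ₐ[ℂ] A}
    (hR : IsNCSmooth R) (hπ : IsAbelianization π) {m : ℕ} (hm : 2 ≤ m) {z : R}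
    (hz : ∀ b, z * b - b * z ∈ commFiltration R (m + 1)) :
    ∃ z', (∀ b, z' * b = b * z') ∧ z' - z ∈ commFiltration R m := by
  choose! f hf hfc using fun (j : ℕ) (x : R)
    (hx : ∀ b, x * b - b * x ∈ commFiltration R (m + j + 1)) =>
      exists_sub_commutator_mem hR hπ (by omega : 2 ≤ m + j) hx
  let x : ℕ → R := fun n => Nat.rec z (fun j x => x - f j x) n
  have hx : ∀ n, ∀ b, x n * b - b * x n ∈ commFiltration R (m + n + 1) := by
    intro n
    induction n with
    | zero => exact hz
    | succ n ih => exact hfc n _ ih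
  have hstep : ∀ n, x (n + 1) - x n ∈ commFiltration R (m + n) := by
    intro n
    have : x (n + 1) - x n = -f n (x n) := by
      change x n - f n (x n) - x n = _
      abel
    rw [this]
    exact neg_mem (hf n _ (hx n))
  have hxz : ∀ n, x n - z ∈ commFiltration R m := by
    intro n
    induction n with
    | zero => change z - z ∈ _; rw [sub_self]; exact zero_mem _
    | succ n ih =>
      rw [← sub_add_sub_cancel (x (n + 1)) (x n) z]
      exact add_mem (commFiltration_antitone (by omega) (hstep n)) ih
  obtain ⟨y, hy⟩ := hR.1.2 x fun n => commFiltration_antitone (by omega) (hstep n)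
  refine ⟨y, fun b => ?_, ?_⟩
  · refine sub_eq_zero.1 (hR.1.1 _ fun n => ?_)
    have e : y * b - b * y = (y - x n) * b - b * (y - x n) + (x n * b - b * x n) := by
      noncomm_ring
    rw [e]
    exact add_mem (sub_mem (TwoSidedIdeal.mul_mem_right _ _ _ (hy n))
      (TwoSidedIdeal.mul_mem_left _ _ _ (hy n)))
      (commFiltration_antitone (by omega) (hx n b))
  · rw [← sub_add_sub_cancel y (x m) z]
    exact add_mem (hy m) (hxz m)

lemma pow_mem_commFiltration {t : R} (ht : t ∈ commFiltration R 2) (n : ℕ) :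
    t ^ n ∈ commFiltration R n := by
  induction n with
  | zero => exact mem_commFiltration_zero _
  | succ n ih =>
    rw [pow_succ]
    exact commFiltration_antitone (by omega) (commFiltration_mul_mem ih ht)

lemma isUnit_of_sub_one_mem (hR : IsNCComplete R) {x : R} (hx : x - 1 ∈ commFiltration R 2) :
    IsUnit x := by
  have ht : 1 - x ∈ commFiltration R 2 := by rw [← neg_sub]; exact neg_mem hx
  obtain ⟨y, hy⟩ := hR.2 (fun n => ∑ i ∈ Finset.range n, (1 - x) ^ i) fun n => by
    rw [Finset.sum_range_succ, add_sub_cancel_left]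
    exact pow_mem_commFiltration ht n
  have h1 : ∀ n, x * ∑ i ∈ Finset.range n, (1 - x) ^ i = 1 - (1 - x) ^ n := fun n => by
    simpa using mul_neg_geom_sum (1 - x) n
  have h2 : ∀ n, (∑ i ∈ Finset.range n, (1 - x) ^ i) * x = 1 - (1 - x) ^ n := fun n => by
    simpa using geom_sum_mul_neg (1 - x) n
  refine isUnit_iff_exists.2 ⟨y, sub_eq_zero.1 (hR.1 _ fun n => ?_),
    sub_eq_zero.1 (hR.1 _ fun n => ?_)⟩
  · have := sub_mem (TwoSidedIdeal.mul_mem_left _ x _ (hy n)) (pow_mem_commFiltration ht n)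
    rwa [mul_sub, h1, sub_sub, sub_add_cancel] at this
  · have := sub_mem (TwoSidedIdeal.mul_mem_right _ _ x (hy n)) (pow_mem_commFiltration ht n)
    rwa [sub_mul, h2, sub_sub, sub_add_cancel] at this

lemma isUnit_of_mul_sub_one_mem (hR : IsNCComplete R) {x y : R}
    (h : x * y - 1 ∈ commFiltration R 2) (h' : y * x - 1 ∈ commFiltration R 2) : IsUnit x := by
  obtain ⟨a, ha⟩ := (isUnit_of_sub_one_mem hR h).exists_right_inv
  obtain ⟨b, hb⟩ := (isUnit_of_sub_one_mem hR h').exists_left_inv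
  rw [mul_assoc] at ha
  rw [← mul_assoc] at hb
  refine isUnit_iff_exists.2 ⟨_, ha, ?_⟩
  rwa [← left_inv_eq_right_inv hb ha]

lemma isUnit_of_sub_mem (hR : IsNCComplete R) {x : R} (v : Rˣ)
    (h : x - v ∈ commFiltration R 2) : IsUnit x := by
  refine isUnit_of_mul_sub_one_mem (y := ↑v⁻¹) hR ?_ ?_
  · have := TwoSidedIdeal.mul_mem_right _ _ (↑v⁻¹ : R) h
    rwa [sub_mul, Units.mul_inv] at this
  · have := TwoSidedIdeal.mul_mem_left _ (↑v⁻¹ : R) _ h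
    rwa [mul_sub, Units.inv_mul] at this

lemma exists_unit_lift (hR : IsNCComplete R) {Q : Type} [Ring Q] [Algebra ℂ Q] {d : ℕ}
    {p : R →ₐ[ℂ] Q} (hp : Function.Surjective p ∧ ∀ x, p x = 0 ↔ x ∈ commFiltration R (d + 2))
    (u : Qˣ) : ∃ v : Rˣ, p v = u ∧ p ↑v⁻¹ = ↑u⁻¹ := by
  obtain ⟨x, hx⟩ := hp.1 u
  obtain ⟨y, hy⟩ := hp.1 ↑u⁻¹
  have hxu : IsUnit x := by
    refine isUnit_of_mul_sub_one_mem (y := y) hR ?_ ?_ <;>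
      refine commFiltration_antitone (by omega : 2 ≤ d + 2) ((hp.2 _).1 ?_)
    · rw [map_sub, map_mul, hx, hy, map_one, Units.mul_inv, sub_self]
    · rw [map_sub, map_mul, hx, hy, map_one, Units.inv_mul, sub_self]
  obtain ⟨v, rfl⟩ := hxu
  refine ⟨v, hx, ?_⟩
  have h := left_inv_eq_right_inv (show (↑u⁻¹ : Q) * p v = 1 by rw [hx, Units.inv_mul])
    (show p v * p ↑v⁻¹ = 1 by rw [← map_mul, Units.mul_inv, map_one])
  exact h.symm

variable {R' : Type} [Ring R'] [Algebra ℂ R']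

/-- A conjugator of two isomorphisms modulo `I_{m+1}` can be improved to one modulo `I_{m+2}`,
once some conjugator modulo `I_{m+2}` exists. -/
lemma exists_conjugator_succ {A : Type} [CommRing A] [Algebra ℂ A] {π : R' →ₐ[ℂ] A}
    (hR' : IsNCSmooth R') (hπ : IsAbelianization π) (Φ Ψ : R ≃ₐ[ℂ] R') {m : ℕ} (hm : 2 ≤ m)
    (w v : R'ˣ) (hw : ∀ a, Ψ a * w - w * Φ a ∈ commFiltration R' (m + 1))
    (hv : ∀ a, Ψ a * v - v * Φ a ∈ commFiltration R' (m + 2)) :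
    ∃ w' : R'ˣ, (∀ a, Ψ a * w' - w' * Φ a ∈ commFiltration R' (m + 2)) ∧
      (w' - w : R') ∈ commFiltration R' m := by
  have hz : ∀ b, (↑w⁻¹ * v : R') * b - b * (↑w⁻¹ * v) ∈ commFiltration R' (m + 1) := by
    intro b
    obtain ⟨a, rfl⟩ := Φ.surjective b
    have e : (↑w⁻¹ * v : R') * Φ a - Φ a * (↑w⁻¹ * v)
        = ↑w⁻¹ * (Ψ a * w - w * Φ a) * (↑w⁻¹ * v) - ↑w⁻¹ * (Ψ a * v - v * Φ a) := by
      have h1 : (↑w⁻¹ : R') * (w * Φ a) = Φ a := Units.inv_mul_cancel_left w _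
      have h2 : (w : R') * (↑w⁻¹ * v) = v := Units.mul_inv_cancel_left w _
      rw [mul_sub, mul_sub, sub_mul, h1, mul_assoc _ (Ψ a * (w : R')), mul_assoc (Ψ a), h2,
        mul_assoc]
      abel
    rw [e]
    exact sub_mem (TwoSidedIdeal.mul_mem_right _ _ _ (TwoSidedIdeal.mul_mem_left _ _ _ (hw a)))
      (TwoSidedIdeal.mul_mem_left _ _ _ (commFiltration_antitone (by omega) (hv a)))
  obtain ⟨z, hzc, hzw⟩ := exists_central_sub_mem hR' hπ hm hz
  obtain ⟨c, rfl⟩ := isUnit_of_sub_mem hR'.1 (w⁻¹ * v)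
    (by rw [Units.val_mul]; exact commFiltration_antitone hm hzw)
  have hc : ∀ b, (↑c⁻¹ : R') * b = b * ↑c⁻¹ := by
    intro b
    rw [Units.inv_mul_eq_iff_eq_mul, ← mul_assoc, hzc, mul_assoc, Units.mul_inv, mul_one]
  refine ⟨v * c⁻¹, fun a => ?_, ?_⟩
  · have e : Ψ a * ↑(v * c⁻¹) - ↑(v * c⁻¹) * Φ a = (Ψ a * v - v * Φ a) * (↑c⁻¹ : R') := by
      rw [Units.val_mul, mul_assoc (v : R'), hc, sub_mul, mul_assoc, mul_assoc]
    rw [e]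
    exact TwoSidedIdeal.mul_mem_right _ _ _ (hv a)
  · have e : (↑(v * c⁻¹) - w : R') = -(w * (c - ↑w⁻¹ * v) * ↑c⁻¹) := by
      rw [Units.val_mul, mul_sub, Units.mul_inv_cancel_left, sub_mul, mul_assoc, Units.mul_inv,
        mul_one, neg_sub]
    rw [e]
    exact neg_mem (TwoSidedIdeal.mul_mem_right _ _ _ (TwoSidedIdeal.mul_mem_left _ _ _ hzw))

/-- Isomorphisms to an NC-smooth algebra which are conjugate modulo every term of the commutator
filtration are conjugate. -/
theorem conjugate_of_forall_sub_mem {A : Type} [CommRing A] [Algebra ℂ A] {π : R' →ₐ[ℂ] A}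
    (hR' : IsNCSmooth R') (hπ : IsAbelianization π) (Φ Ψ : R ≃ₐ[ℂ] R')
    (h : ∀ d, ∃ v : R'ˣ, ∀ a, Ψ a * v - v * Φ a ∈ commFiltration R' d) :
    Conjugate Φ.toAlgHom Ψ.toAlgHom := by
  choose v hv using h
  choose! f hf hfw using fun (n : ℕ) (w : R'ˣ)
    (hw : ∀ a, Ψ a * w - w * Φ a ∈ commFiltration R' (n + 2 + 1)) =>
      exists_conjugator_succ hR' hπ Φ Ψ (by omega : 2 ≤ n + 2) w (v (n + 2 + 2)) hw (hv _)
  obtain ⟨w, hw0, hws⟩ : ∃ w : ℕ → R'ˣ, w 0 = v 3 ∧ ∀ n, w (n + 1) = f n (w n) :=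
    ⟨fun n => Nat.rec (v 3) (fun j x => f j x) n, rfl, fun _ => rfl⟩
  have hw : ∀ n, ∀ a, Ψ a * (w n : R') - (w n : R') * Φ a ∈ commFiltration R' (n + 2 + 1) := by
    intro n
    induction n with
    | zero => rw [hw0]; exact hv 3
    | succ n ih =>
      intro a
      rw [hws]
      exact commFiltration_antitone (by omega) (hf n _ ih a)
  have hstep : ∀ n, ((w (n + 1) : R') - (w n : R')) ∈ commFiltration R' (n + 2) := fun n => by
    rw [hws]; exact hfw n _ (hw n)
  obtain ⟨y, hy⟩ := hR'.1.2 (fun n => (w n : R')) fun n =>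
    commFiltration_antitone (by omega) (hstep n)
  obtain ⟨u, rfl⟩ := isUnit_of_sub_mem hR'.1 (w 2) (hy 2)
  refine ⟨u, fun a => ?_⟩
  rw [Units.eq_mul_inv_iff_mul_eq]
  refine sub_eq_zero.1 (hR'.1.1 _ fun n => ?_)
  change Ψ a * u - u * Φ a ∈ _
  have e : Ψ a * u - u * Φ a
      = Ψ a * (u - w n) - (u - w n) * Φ a + (Ψ a * w n - w n * Φ a) := by noncomm_ring
  rw [e]
  exact add_mem (sub_mem (TwoSidedIdeal.mul_mem_left _ _ _ (hy n))
    (TwoSidedIdeal.mul_mem_right _ _ _ (hy n))) (commFiltration_antitone (by omega) (hw n a))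

/-- Compatible homomorphisms to the quotients of an NC-complete algebra have a limit. -/
lemma exists_limit_hom (hR' : IsNCComplete R') {Q : ℕ → Type} [∀ d, Ring (Q d)]
    [∀ d, Algebra ℂ (Q d)] {p : ∀ d, R' →ₐ[ℂ] Q d}
    (hp : ∀ d, Function.Surjective (p d) ∧ ∀ x, p d x = 0 ↔ x ∈ commFiltration R' (d + 2))
    (q : ∀ d, Q (d + 1) →ₐ[ℂ] Q d) (hq : ∀ d, (q d).comp (p (d + 1)) = p d)
    (ψ : ∀ d, R →ₐ[ℂ] Q d) (hψ : ∀ d, (q d).comp (ψ (d + 1)) = ψ d) :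
    ∃ Φ : R →ₐ[ℂ] R', ∀ d, (p d).comp Φ = ψ d := by
  have huniq : ∀ y y' : R', (∀ d, p d y = p d y') → y = y' := by
    intro y y' h
    refine sub_eq_zero.1 (hR'.1 _ fun n => commFiltration_antitone (by omega : n ≤ n + 2)
      (((hp n).2 _).1 ?_))
    rw [map_sub, h, sub_self]
  have hex : ∀ r, ∃ y : R', ∀ d, p d y = ψ d r := by
    intro r
    choose y hy using fun d => (hp d).1 (ψ d r)
    have hstep : ∀ d, y (d + 1) - y d ∈ commFiltration R' (d + 2) := by
      intro d
      rw [← (hp d).2, map_sub, hy, sub_eq_zero]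
      calc p d (y (d + 1)) = q d (p (d + 1) (y (d + 1))) := (AlgHom.congr_fun (hq d) _).symm
        _ = ψ d r := by rw [hy]; exact AlgHom.congr_fun (hψ d) r
    obtain ⟨z, hz⟩ := hR'.2 y fun n => commFiltration_antitone (by omega) (hstep n)
    refine ⟨z, fun d => ?_⟩
    rw [← hy, ← sub_eq_zero, ← map_sub, (hp d).2]
    have e : z - y d = (z - y (d + 2)) + ((y (d + 1 + 1) - y (d + 1)) + (y (d + 1) - y d)) := by
      abel
    rw [e]
    exact add_mem (hz (d + 2)) (add_mem (commFiltration_antitone (by omega) (hstep (d + 1)))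
      (hstep d))
  choose Φ hΦ using hex
  refine ⟨AlgHom.ofLinearMap
    { toFun := Φ
      map_add' := fun a b => huniq _ _ fun d => by simp only [hΦ, map_add]
      map_smul' := fun c a => huniq _ _ fun d => by simp only [hΦ, map_smul, RingHom.id_apply] }
    (huniq _ _ fun d => ?_) (fun a b => huniq _ _ fun d => ?_), fun d => AlgHom.ext fun r => hΦ r d⟩
  · simp only [LinearMap.coe_mk, AddHom.coe_mk, hΦ, map_one]
  · simp only [LinearMap.coe_mk, AddHom.coe_mk, hΦ, map_mul]

lemma exists_limit_equiv (hR : IsNCComplete R) (hR' : IsNCComplete R') {Q : ℕ → Type}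
    [∀ d, Ring (Q d)] [∀ d, Algebra ℂ (Q d)] {p : ∀ d, R' →ₐ[ℂ] Q d}
    (hp : ∀ d, Function.Surjective (p d) ∧ ∀ x, p d x = 0 ↔ x ∈ commFiltration R' (d + 2))
    (q : ∀ d, Q (d + 1) →ₐ[ℂ] Q d) (hq : ∀ d, (q d).comp (p (d + 1)) = p d)
    (ψ : ∀ d, R →ₐ[ℂ] Q d) (hψ : ∀ d, (q d).comp (ψ (d + 1)) = ψ d)
    (hker : ∀ d, Function.Surjective (ψ d) ∧ ∀ x, ψ d x = 0 ↔ x ∈ commFiltration R (d + 2)) :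
    ∃ Φ : R ≃ₐ[ℂ] R', ∀ d, (p d).comp Φ.toAlgHom = ψ d := by
  obtain ⟨Φ, hΦ⟩ := exists_limit_hom hR' hp q hq ψ hψ
  have hΦ' : ∀ d r, p d (Φ r) = ψ d r := fun d r => AlgHom.congr_fun (hΦ d) r
  refine ⟨AlgEquiv.ofBijective Φ ⟨(injective_iff_map_eq_zero Φ).2 fun r hr => ?_, fun y => ?_⟩,
    fun d => AlgHom.ext fun r => hΦ' d r⟩
  · refine hR.1 _ fun n => commFiltration_antitone (by omega : n ≤ n + 2) (((hker n).2 _).1 ?_)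
    rw [← hΦ', hr, map_zero]
  · choose r hr using fun d => (hker d).1 (p d y)
    obtain ⟨x, hx⟩ := hR.2 r fun d => commFiltration_antitone (by omega : d ≤ d + 2) (by
      rw [← (hker d).2, map_sub, hr, sub_eq_zero]
      calc ψ d (r (d + 1)) = q d (ψ (d + 1) (r (d + 1))) := (AlgHom.congr_fun (hψ d) _).symm
        _ = p d y := by rw [hr]; exact AlgHom.congr_fun (hq d) y)
    refine ⟨x, sub_eq_zero.1 (hR'.1 _ fun n => ?_)⟩
    rw [← sub_add_sub_cancel (Φ x) (Φ (r n)) y, ← map_sub]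
    refine add_mem (commFiltration_map Φ (hx n)) (commFiltration_antitone (by omega : n ≤ n + 2) ?_)
    rw [← (hp n).2, map_sub, hΦ', hr, sub_self]

/-- Conjugation by a unit, as an algebra automorphism. -/
def unitConj {B : Type} [Ring B] [Algebra ℂ B] (u : Bˣ) : B ≃ₐ[ℂ] B :=
  MulSemiringAction.toAlgEquiv ℂ B (ConjAct.toConjAct u)

end Completion

/-- A system of isomorphisms of the quotients, compatible up to conjugation, comes from an
isomorphism of the NC-complete algebras. -/
theorem exists_equiv_of_conjugate_system {R R' : Type} [Ring R] [Algebra ℂ R] [Ring R']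
    [Algebra ℂ R'] (hR : IsNCComplete R) (hR' : IsNCComplete R')
    {Q Q' : ℕ → Type} [∀ d, Ring (Q d)] [∀ d, Algebra ℂ (Q d)]
    [∀ d, Ring (Q' d)] [∀ d, Algebra ℂ (Q' d)]
    {p : ∀ d, R →ₐ[ℂ] Q d}
    (hp : ∀ d, Function.Surjective (p d) ∧ ∀ x : R, p d x = 0 ↔ x ∈ commFiltration R (d + 2))
    {p' : ∀ d, R' →ₐ[ℂ] Q' d}
    (hp' : ∀ d, Function.Surjective (p' d) ∧
      ∀ x : R', p' d x = 0 ↔ x ∈ commFiltration R' (d + 2))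
    {q : ∀ d, Q (d + 1) →ₐ[ℂ] Q d} (hq : ∀ d, (q d).comp (p (d + 1)) = p d)
    {q' : ∀ d, Q' (d + 1) →ₐ[ℂ] Q' d} (hq' : ∀ d, (q' d).comp (p' (d + 1)) = p' d)
    (φ : ∀ d, Q d ≃ₐ[ℂ] Q' d)
    (hφ : ∀ d, Conjugate ((q' d).comp (φ (d + 1)).toAlgHom) ((φ d).toAlgHom.comp (q d))) :
    ∃ Φ : R ≃ₐ[ℂ] R', ∀ d,
      Conjugate ((p' d).comp Φ.toAlgHom) ((φ d).toAlgHom.comp (p d)) := by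
  choose u hu using hφ
  choose U hU hU' using fun d => exists_unit_lift hR' (hp' d) (u d)
  obtain ⟨G, hG⟩ : ∃ G : ℕ → R'ˣ, ∀ d, G (d + 1) = G d * U d :=
    ⟨fun n => Nat.rec 1 (fun d x => x * U d) n, fun _ => rfl⟩
  let g : ∀ d, (Q' d)ˣ := fun d => Units.map (p' d : R' →* Q' d) (G d)
  have hqp : ∀ d x, q' d (p' (d + 1) x) = p' d x := fun d => AlgHom.congr_fun (hq' d)
  let ψ : ∀ d, R →ₐ[ℂ] Q' d :=
    fun d => (unitConj (g d)).toAlgHom.comp ((φ d).toAlgHom.comp (p d))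
  have hψ : ∀ d, (q' d).comp (ψ (d + 1)) = ψ d := by
    intro d
    ext x
    have h : φ d (p d x) = u d * q' d (φ (d + 1) (p (d + 1) x)) * ↑(u d)⁻¹ := by
      rw [← AlgHom.congr_fun (hq d) x]
      exact hu d (p (d + 1) x)
    change q' d (p' (d + 1) ↑(G (d + 1)) * φ (d + 1) (p (d + 1) x) * p' (d + 1) ↑(G (d + 1))⁻¹)
      = p' d ↑(G d) * φ d (p d x) * p' d ↑(G d)⁻¹
    rw [hG, map_mul, map_mul, hqp, hqp, h, mul_inv_rev, Units.val_mul, Units.val_mul, map_mul,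
      map_mul, hU, hU']
    simp only [mul_assoc]
  have hker : ∀ d, Function.Surjective (ψ d) ∧ ∀ x, ψ d x = 0 ↔ x ∈ commFiltration R (d + 2) :=
    fun d => ⟨(unitConj (g d)).surjective.comp ((φ d).surjective.comp (hp d).1), fun x => by
      rw [← (hp d).2]
      exact (map_eq_zero_iff _ (unitConj (g d)).injective).trans
        (map_eq_zero_iff _ (φ d).injective)⟩
  obtain ⟨Φ, hΦ⟩ := exists_limit_equiv hR hR' hp' q' hq' ψ hψ hker
  refine ⟨Φ, fun d => ⟨(g d)⁻¹, fun a => ?_⟩⟩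
  have h : p' d (Φ a) = g d * φ d (p d a) * ↑(g d)⁻¹ := AlgHom.congr_fun (hΦ d) a
  change φ d (p d a) = ↑(g d)⁻¹ * p' d (Φ a) * ↑(g d)⁻¹⁻¹
  rw [h, inv_inv, mul_assoc (g d : Q' d), Units.inv_mul_cancel_left, Units.inv_mul_cancel_right]

end NCGeom

open NCGeom in
/-- The functor `R ↦ h̄_R` from (NC-smooth algebras, isomorphisms up to
conjugation) to (functors on `a𝒩`, natural isomorphisms) is fully faithful.  Equivalently
(since `h̄_R|_{a𝒩_d} ≅ h̄_{R/I_{d+2}R}`), for NC-smooth algebras `R, R'` the natural map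
from conjugacy classes of isomorphisms `R ≃ R'` to the inverse limit over `d` of conjugacy
classes of isomorphisms `R/I_{d+2}R ≃ R'/I_{d+2}R'` is a bijection.  Here the quotients are
presented by surjections `p d : R → Q d` with kernel `I_{d+2}R` and transition maps
`q d : Q (d+1) → Q d`, and a point of the inverse limit is a system of isomorphisms
`φ d : Q d ≃ Q' d` compatible with the transition maps up to conjugation. -/
theorem hbar_fully_faithful
    (R R' : Type) [Ring R] [Algebra ℂ R] [Ring R'] [Algebra ℂ R']
    (hR : IsNCSmooth R) (hR' : IsNCSmooth R')
    (Q Q' : ℕ → Type) [∀ d, Ring (Q d)] [∀ d, Algebra ℂ (Q d)]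
    [∀ d, Ring (Q' d)] [∀ d, Algebra ℂ (Q' d)]
    (p : ∀ d, R →ₐ[ℂ] Q d)
    (hp : ∀ d, Function.Surjective (p d) ∧ ∀ x : R, p d x = 0 ↔ x ∈ commFiltration R (d + 2))
    (p' : ∀ d, R' →ₐ[ℂ] Q' d)
    (hp' : ∀ d, Function.Surjective (p' d) ∧
      ∀ x : R', p' d x = 0 ↔ x ∈ commFiltration R' (d + 2))
    (q : ∀ d, Q (d + 1) →ₐ[ℂ] Q d) (hq : ∀ d, (q d).comp (p (d + 1)) = p d)
    (q' : ∀ d, Q' (d + 1) →ₐ[ℂ] Q' d) (hq' : ∀ d, (q' d).comp (p' (d + 1)) = p' d) :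
    -- surjectivity: every compatible system of isomorphisms of the quotients, up to
    -- conjugation, comes from an isomorphism `R ≃ R'`:
    (∀ φ : ∀ d, Q d ≃ₐ[ℂ] Q' d,
      (∀ d, Conjugate ((q' d).comp (φ (d + 1)).toAlgHom) ((φ d).toAlgHom.comp (q d))) →
      ∃ Φ : R ≃ₐ[ℂ] R', ∀ d,
        Conjugate ((p' d).comp Φ.toAlgHom) ((φ d).toAlgHom.comp (p d))) ∧
    -- injectivity: two isomorphisms `R ≃ R'` that are conjugate on every quotient are
    -- conjugate:
    (∀ Φ Ψ : R ≃ₐ[ℂ] R',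
      (∀ d, Conjugate ((p' d).comp Φ.toAlgHom) ((p' d).comp Ψ.toAlgHom)) →
      Conjugate Φ.toAlgHom Ψ.toAlgHom) := by
  refine ⟨fun φ hφ => exists_equiv_of_conjugate_system hR.1 hR'.1 hp hp' hq hq' φ hφ,
    fun Φ Ψ h => ?_⟩
  have hcomm : ∀ x y : Q' 0, x * y = y * x := by
    intro x y
    obtain ⟨a, rfl⟩ := (hp' 0).1 x
    obtain ⟨b, rfl⟩ := (hp' 0).1 y
    rw [← map_mul, ← map_mul, ← sub_eq_zero, ← map_sub, (hp' 0).2]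
    exact commutator_mem_two a b
  let _ : CommRing (Q' 0) := { (inferInstance : Ring (Q' 0)) with mul_comm := hcomm }
  have hπ : IsAbelianization (p' 0) := hp' 0
  refine conjugate_of_forall_sub_mem hR' hπ Φ Ψ fun d => ?_
  obtain ⟨u, hu⟩ := h d
  obtain ⟨v, hv, -⟩ := exists_unit_lift hR'.1 (hp' d) u
  refine ⟨v, fun a => commFiltration_antitone (by omega : d ≤ d + 2) (((hp' d).2 _).1 ?_)⟩
  have e : p' d (Ψ a) = u * p' d (Φ a) * ↑u⁻¹ := hu a
  rw [map_sub, map_mul, map_mul, hv, e, Units.inv_mul_cancel_right, sub_self]
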